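/- arXiv:2011.10056 — 9 statements merged into one kernel-verified Lean document; each statement's English description precedes it below -/
import Mathlib

section
/- Let A : ℝ^d → ℝ^d be real-analytic, fix x ∈ ℝ^d and T > 0, and suppose ξ̂ : [0, T] → ℝ^d is continuous with ξ̂(0) = x and satisfies the footpoint equation x = ξ̂(t) + A(ξ̂(t)) t for all t ∈ [0, T]. Define the fixpoint iteration ξ̂⁽⁰⁾(t) := x and ξ̂⁽ⁿ⁾(t) := x − A(ξ̂⁽ⁿ⁻¹⁾(t)) t for n ≥ 1. Then for every n ∈ ℕ, ‖ξ̂⁽ⁿ⁾(t) − ξ̂(t)‖ = O(t^{n+1}) as t → 0⁺. -/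
open Asymptotics Filter Topology

/-- The characteristic-footpoint fixpoint iteration `ξ̂⁽⁰⁾(t) = x`,
`ξ̂⁽ⁿ⁾(t) = x − t • A(ξ̂⁽ⁿ⁻¹⁾(t))` approximates the exact footpoint `ξ̂(t)`
(satisfying `x = ξ̂(t) + t • A(ξ̂(t))`) to order `t^{n+1}` as `t → 0⁺`. -/
theorem stmt_1 (d : ℕ) (T : ℝ) (hT : 0 < T)
    (A : EuclideanSpace ℝ (Fin d) → EuclideanSpace ℝ (Fin d))
    (hA : AnalyticOnNhd ℝ A Set.univ)
    (x : EuclideanSpace ℝ (Fin d))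
    (ξ : ℝ → EuclideanSpace ℝ (Fin d))
    (hξcont : ContinuousOn ξ (Set.Icc 0 T))
    (hξ0 : ξ 0 = x)
    (hfoot : ∀ t ∈ Set.Icc 0 T, x = ξ t + t • A (ξ t))
    (ξiter : ℕ → ℝ → EuclideanSpace ℝ (Fin d))
    (hiter0 : ∀ t, ξiter 0 t = x)
    (hiterrec : ∀ n t, ξiter (n + 1) t = x - t • A (ξiter n t)) :
    ∀ n : ℕ, (fun t => ‖ξiter n t - ξ t‖) =O[𝓝[>] (0 : ℝ)] fun t => t ^ (n + 1) := by
  have hmem : ∀ᶠ t in 𝓝[>] (0 : ℝ), t ∈ Set.Icc 0 T := by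
    filter_upwards [Ioc_mem_nhdsGT hT] with t ht
    exact ⟨ht.1.le, ht.2⟩
  have hid : Tendsto (fun t : ℝ => t) (𝓝[>] (0 : ℝ)) (𝓝 0) :=
    tendsto_id.mono_left nhdsWithin_le_nhds
  have hξ : Tendsto ξ (𝓝[>] (0 : ℝ)) (𝓝 x) := by
    have h := hξcont 0 ⟨le_refl _, hT.le⟩
    rw [ContinuousWithinAt, hξ0] at h
    exact h.mono_left (le_inf nhdsWithin_le_nhds (le_principal_iff.2 hmem))
  have hAx := hA x (Set.mem_univ x)
  have hAc : Tendsto A (𝓝 x) (𝓝 (A x)) := hAx.continuousAt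
  have hit : ∀ n, Tendsto (ξiter n) (𝓝[>] (0 : ℝ)) (𝓝 x) := by
    intro n
    induction n with
    | zero =>
      have : ξiter 0 = fun _ => x := funext hiter0
      rw [this]
      exact tendsto_const_nhds
    | succ n ih =>
      have : ξiter (n + 1) = fun t => x - t • A (ξiter n t) := funext (hiterrec n)
      rw [this]
      simpa using (tendsto_const_nhds (x := x)).sub (hid.smul (hAc.comp ih))
  intro n
  refine IsBigO.norm_left ?_
  induction n with
  | zero =>
    have h1 : (fun t => t • A (ξ t)) =O[𝓝[>] (0 : ℝ)] fun t => t • (1 : ℝ) :=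
      (isBigO_refl _ _).smul ((hAc.comp hξ).isBigO_one ℝ)
    refine h1.congr' ?_ (Eventually.of_forall fun t => by simp)
    filter_upwards [hmem] with t ht
    rw [hiter0, sub_eq_of_eq_add' (hfoot t ht)]
  | succ n ih =>
    have h2 := hAx.hasStrictFDerivAt.isBigO_sub.comp_tendsto ((hit n).prodMk_nhds hξ)
    have h3 : (fun t => t • (A (ξ t) - A (ξiter n t))) =O[𝓝[>] (0 : ℝ)]
        fun t => t • t ^ (n + 1) :=
      (isBigO_refl _ _).smul
        ((h2.trans ih).neg_left.congr_left fun t => by simp)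
    refine h3.congr' ?_ (Eventually.of_forall fun t => by simp [pow_succ']) 
    filter_upwards [hmem] with t ht
    have := hfoot t ht
    rw [hiterrec, smul_sub]
    nth_rewrite 1 [this]
    abel
end

section
/- Let f : ℝ^m → ℝ^m be smooth with Jacobian J(q) = ∇_q f(q), and let R : ℝ^m → GL_m(ℝ) and λ₁, …, λ_m : ℝ^m → ℝ be smooth with R(q) J(q) R(q)⁻¹ = diag(λ₁(q), …, λ_m(q)). Let q : [0,T] × ℝ → ℝ^m be a smooth solution of ∂_t q + ∂_x f(q) = 0 with q₀ := q(0, ·). Fix x ∈ ℝ, write λ_i(x) := λ_i(q₀(x)) and F^{(k)}(x) := F^{(k)}(q₀(x)). For i = 1, …, m define the predictor q^{(i)}(t) ∈ ℝ^m by q^{(i)}_β(t) := Σ_{k,α=1}^m F^{(k)}_{βα}(x) q_{α,0}(x − t (λ_i(x) + λ_k(x))/2), set λ_i* := λ_i(q^{(i)}(t)), and let R* be the m×m matrix whose i-th row is the i-th row of R(q^{(i)}(t)). Then for all sufficiently small t > 0 the matrix R* is invertible, and the approximate solution operator q̃_ℓ(t, x) := Σ_{i=1}^m (R*)⁻¹_{ℓi}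 Σ_{j=1}^m R*_{ij} q_{j,0}(x − λ_i* t) satisfies q̃(t, x) = q(t, x) + O(t³) as t → 0⁺. -/
open Asymptotics Filter Topology

lemma bigO_step (g : ℝ → ℝ) (n : ℕ) (hg : Differentiable ℝ g) (h0 : g 0 = 0)
    (h1 : deriv g =O[𝓝 0] fun t => t ^ n) : g =O[𝓝 0] fun t => t ^ (n+1) := by
  obtain ⟨C, hC⟩ := h1.bound
  obtain ⟨ε, hε, hb⟩ := Metric.eventually_nhds_iff.1 hC
  refine IsBigO.of_bound C ?_
  refine Metric.eventually_nhds_iff.2 ⟨ε, hε, fun t ht => ?_⟩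
  have key := (convex_closedBall (0:ℝ) |t|).norm_image_sub_le_of_norm_deriv_le (f := g)
    (C := C * |t| ^ n) (x := 0) (y := t) (fun y _ => hg y) (fun y hy => by
      have hy' : |y| ≤ |t| := by simpa using hy
      have ht' : |t| < ε := by simpa using ht
      have h := hb (y := y) (by simpa using hy'.trans_lt ht')
      have hC0 : 0 ≤ C ∨ y ^ n = 0 := by
        by_contra hcon
        push Not at hcon
        have : 0 < ‖y ^ n‖ := norm_pos_iff.2 hcon.2
        nlinarith [norm_nonneg (deriv g y)]
      have hCt : 0 ≤ C * |t|^n := by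
        have h := hb (y := t) ht
        rw [norm_pow, Real.norm_eq_abs t] at h
        exact (norm_nonneg _).trans h
      rcases hC0 with hC0 | hC0
      · refine h.trans ?_
        rw [norm_pow, Real.norm_eq_abs]
        gcongr
      · rw [hC0] at h
        refine h.trans ?_
        simpa using hCt) (by simp) (by simp)
  rw [h0] at key
  simp only [sub_zero] at key
  refine key.trans (le_of_eq ?_)
  rw [norm_pow, Real.norm_eq_abs]; ring

lemma bigO_three (g : ℝ → ℝ) (hg : ContDiff ℝ (⊤ : ℕ∞) g) (h0 : g 0 = 0) (h1 : deriv g 0 = 0)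
    (h2 : deriv (deriv g) 0 = 0) : g =O[𝓝 0] fun t => t ^ 3 := by
  have hg1 : ContDiff ℝ (⊤ : ℕ∞) (deriv g) := (contDiff_infty_iff_deriv.1 hg).2
  have hg2 : ContDiff ℝ (⊤ : ℕ∞) (deriv (deriv g)) := (contDiff_infty_iff_deriv.1 hg1).2
  have hg3 : ContDiff ℝ (⊤ : ℕ∞) (deriv (deriv (deriv g))) := (contDiff_infty_iff_deriv.1 hg2).2
  have e3 : deriv (deriv (deriv g)) =O[𝓝 0] fun t : ℝ => t ^ 0 := by
    simp only [pow_zero]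
    exact hg3.continuous.continuousAt.isBigO_one ℝ
  exact bigO_step g 2 (hg.differentiable (by simp)) h0
    (bigO_step _ 1 (hg1.differentiable (by simp)) h1
      (bigO_step _ 0 (hg2.differentiable (by simp)) h2 e3))

lemma bigO_pair {E : Type*} [NormedAddCommGroup E] [NormedSpace ℝ E] (L : ℝ → E →L[ℝ] ℝ) (w : ℝ → E) (hL : ContDiff ℝ (⊤ : ℕ∞) L)
    (hw : ContDiff ℝ (⊤ : ℕ∞) w) (w1 w2 : E) (L1 : E →L[ℝ] ℝ) (h0 : w 0 = 0)
    (hw1 : deriv w 0 = w1) (hw2 : deriv (deriv w) 0 = w2) (hL1 : deriv L 0 = L1)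
    (e1 : L 0 w1 = 0) (e2 : 2 * L1 w1 + L 0 w2 = 0) :
    (fun t => L t (w t)) =O[𝓝 0] fun t => t ^ 3 := by
  have dL : ∀ t, HasDerivAt L (deriv L t) t := fun t =>
    (hL.differentiable (by simp) t).hasDerivAt
  have dw : ∀ t, HasDerivAt w (deriv w t) t := fun t =>
    (hw.differentiable (by simp) t).hasDerivAt
  have dL' : ∀ t, HasDerivAt (deriv L) (deriv (deriv L) t) t := fun t =>
    ((contDiff_infty_iff_deriv.1 hL).2.differentiable (by simp) t).hasDerivAt
  have dw' : ∀ t, HasDerivAt (deriv w) (deriv (deriv w) t) t := fun t =>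
    ((contDiff_infty_iff_deriv.1 hw).2.differentiable (by simp) t).hasDerivAt
  have d1 : deriv (fun t => L t (w t)) = fun t => deriv L t (w t) + L t (deriv w t) :=
    funext fun t => ((dL t).clm_apply (dw t)).deriv
  apply bigO_three _ (hL.clm_apply hw)
  · simp [h0]
  · rw [d1]; simp [h0, hw1, e1]
  · rw [d1]
    have := (((dL' 0).clm_apply (dw 0)).add ((dL 0).clm_apply (dw' 0))).deriv
    refine Eq.trans this ?_
    rw [h0, hw1, hw2, hL1, map_zero]
    linarith

lemma main_abs {E : Type*} [NormedAddCommGroup E] [NormedSpace ℝ E] (T x : ℝ) (hT : 0 < T) (K : E → E →L[ℝ] E) (l : E → E →L[ℝ] ℝ) (μ : E → ℝ)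
    (hK : ContDiff ℝ (⊤ : ℕ∞) K) (hl : ContDiff ℝ (⊤ : ℕ∞) l) (hμ : ContDiff ℝ (⊤ : ℕ∞) μ)
    (heig : ∀ p v, l p (K p v) = μ p * l p v)
    (Q : ℝ × ℝ → E) (hQ : ContDiff ℝ (⊤ : ℕ∞) Q)
    (hPDE : ∀ t ∈ Set.Icc (0:ℝ) T, ∀ y, fderiv ℝ Q (t, y) (1, 0) =
      - K (Q (t, y)) (fderiv ℝ Q (t, y) (0, 1)))
    (γ : ℝ → E) (hγ : ContDiff ℝ (⊤ : ℕ∞) γ) (hγ0 : γ 0 = Q (0, x))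
    (hγ1 : deriv γ 0 = -(1/2 : ℝ) • (μ (Q (0,x)) • fderiv ℝ Q (0, x) (0, 1)
      + K (Q (0,x)) (fderiv ℝ Q (0, x) (0, 1)))) :
    (fun t => l (γ t) (Q (0, x - μ (γ t) * t) - Q (t, x))) =O[𝓝 0] fun t => t ^ 3 := by
  set D := fderiv ℝ Q with hD
  have hDs : ContDiff ℝ (⊤ : ℕ∞) D := hQ.fderiv_right (by simp)
  have hdQ : ∀ z, HasFDerivAt Q (D z) z := fun z => (hQ.differentiable (by simp) z).hasFDerivAt
  have hdD : ∀ z, HasFDerivAt D (fderiv ℝ D z) z :=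
    fun z => (hDs.differentiable (by simp) z).hasFDerivAt
  set S := fderiv ℝ D (0, x) with hS
  have hsymm : S (1,0) (0,1) = S (0,1) (1,0) := by
    have := (hQ.contDiffAt (x := ((0:ℝ), x))).isSymmSndFDerivAt (by
      rw [minSmoothness_of_isRCLikeNormedField]; exact WithTop.coe_le_coe.2 (le_top : (2:ℕ∞) ≤ ⊤))
    exact this _ _
  set p := D (0, x) (0, 1) with hp
  set u := Q (0, x) with hu
  have ct : ∀ t : ℝ, HasDerivAt (fun s : ℝ => (s, x)) ((1:ℝ), (0:ℝ)) t := fun t =>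
    (hasDerivAt_id t).prodMk (hasDerivAt_const t x)
  have cy : ∀ y : ℝ, HasDerivAt (fun s : ℝ => ((0:ℝ), s)) ((0:ℝ), (1:ℝ)) y := fun y =>
    (hasDerivAt_const y (0:ℝ)).prodMk (hasDerivAt_id y)
  have dQt : ∀ t, HasDerivAt (fun s => Q (s, x)) (D (t, x) (1,0)) t := fun t =>
    (hdQ (t, x)).comp_hasDerivAt t (ct t)
  have dQy : ∀ y, HasDerivAt (fun s => Q (0, s)) (D (0, y) (0,1)) y := fun y =>
    (hdQ (0, y)).comp_hasDerivAt y (cy y)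
  have dDt : HasDerivAt (fun s => D (s, x)) (S (1,0)) 0 :=
    (hdD (0, x)).comp_hasDerivAt 0 (ct 0)
  have dDy : HasDerivAt (fun s => D (0, s)) (S (0,1)) x :=
    (hdD (0, x)).comp_hasDerivAt x (cy x)
  have dDt' : ∀ v, HasDerivAt (fun s => D (s, x) v) (S (1,0) v) 0 := fun v => by
    simpa using dDt.clm_apply (hasDerivAt_const 0 v)
  have dDy' : ∀ v, HasDerivAt (fun s => D (0, s) v) (S (0,1) v) x := fun v => by
    simpa using dDy.clm_apply (hasDerivAt_const x v)
  have hdK : HasFDerivAt K (fderiv ℝ K u) u := (hK.differentiable (by simp) u).hasFDerivAt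
  have mem0 : (0:ℝ) ∈ Set.Icc (0:ℝ) T := ⟨le_rfl, hT.le⟩
  have hqt : D (0, x) (1, 0) = - K u p := hPDE 0 mem0 x
  clear_value S D p u
  -- mixed derivative
  have hmix : S (0,1) (1,0) = -(fderiv ℝ K u p p + K u (S (0,1) (0,1))) := by
    have h1 := dDy' (1,0)
    have h2 : HasDerivAt (fun s => - K (Q (0, s)) (D (0, s) (0,1)))
        (-(fderiv ℝ K u p p + K u (S (0,1) (0,1)))) x :=
by
      have hKc : HasDerivAt (fun s => K (Q (0, s))) (fderiv ℝ K u p) x := by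
        have := HasFDerivAt.comp_hasDerivAt x (by rw [← hu]; exact hdK) (dQy x)
        rw [← hp] at this
        exact this
      have := (hKc.clm_apply (dDy' (0,1))).neg
      rw [← hp, ← hu] at this
      exact this
    have h3 : (fun s => D (0, s) (1,0)) = (fun s => - K (Q (0, s)) (D (0, s) (0,1))) :=
      funext fun s => hPDE 0 mem0 s
    rw [h3] at h1
    exact h1.unique h2
  have htt : S (1,0) (1,0) = -(fderiv ℝ K u (-K u p) p + K u (S (1,0) (0,1))) := by
    have h1 := (dDt' (1,0)).hasDerivWithinAt (s := Set.Icc 0 T)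
    have h2 : HasDerivAt (fun s => - K (Q (s, x)) (D (s, x) (0,1)))
        (-(fderiv ℝ K u (D (0,x) (1,0)) p + K u (S (1,0) (0,1)))) 0 :=
by
      have hKc : HasDerivAt (fun s => K (Q (s, x))) (fderiv ℝ K u (D (0,x) (1,0))) 0 :=
        HasFDerivAt.comp_hasDerivAt 0 (by rw [← hu]; exact hdK) (dQt 0)
      have := (hKc.clm_apply (dDt' (0,1))).neg
      rw [← hp, ← hu] at this
      exact this
    rw [hqt] at h2
    have h3 : HasDerivWithinAt (fun s => D (s, x) (1,0)) _ (Set.Icc 0 T) 0 :=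
      h2.hasDerivWithinAt.congr (fun s hs => hPDE s hs x) (hPDE 0 mem0 x)
    exact (uniqueDiffOn_Icc hT 0 mem0).eq_deriv _ h1 h3
  rw [hsymm, hmix] at htt
  -- the characteristic speed along γ
  set v := deriv γ 0 with hv
  have dγ : HasDerivAt γ v 0 := (hγ.differentiable (by simp) 0).hasDerivAt
  have hMs : ContDiff ℝ (⊤ : ℕ∞) (fun t => μ (γ t)) := hμ.comp hγ
  set M := fun t => μ (γ t) with hM
  have dM : ∀ t, HasDerivAt M (deriv M t) t := fun t =>
    (hMs.differentiable (by simp) t).hasDerivAt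
  have dM' : HasDerivAt (deriv M) (deriv (deriv M) 0) 0 :=
    ((contDiff_infty_iff_deriv.1 hMs).2.differentiable (by simp) 0).hasDerivAt
  have dμ : HasFDerivAt μ (fderiv ℝ μ u) u := (hμ.differentiable (by simp) u).hasFDerivAt
  have dl : HasFDerivAt l (fderiv ℝ l u) u := (hl.differentiable (by simp) u).hasFDerivAt
  have hM1 : deriv M 0 = fderiv ℝ μ u v := by
    have := HasFDerivAt.comp_hasDerivAt (0:ℝ) (by rw [hγ0]; exact dμ) dγ
    exact this.deriv
  have hL1 : deriv (fun t => l (γ t)) 0 = fderiv ℝ l u v := by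
    have := HasFDerivAt.comp_hasDerivAt (0:ℝ) (by rw [hγ0]; exact dl) dγ
    exact this.deriv
  have hM0 : M 0 = μ u := by simp [hM, hγ0]
  have dc : ∀ t, HasDerivAt (fun t => x - M t * t) (-(deriv M t * t + M t)) t := fun t => by
    have := ((dM t).mul (hasDerivAt_id t)).const_sub x
    simpa using this
  have hws : ContDiff ℝ (⊤ : ℕ∞) (fun t => Q (0, x - M t * t) - Q (t, x)) := by
    fun_prop
  have dw : deriv (fun t => Q (0, x - M t * t) - Q (t, x)) = fun t =>
      (-(deriv M t * t + M t)) • D (0, x - M t * t) (0,1) - D (t, x) (1,0) := by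
    funext t
    exact (((dQy _).scomp t (dc t)).sub (dQt t)).deriv
  have dw2 : deriv (deriv (fun t => Q (0, x - M t * t) - Q (t, x))) 0 =
      (-(2 * fderiv ℝ μ u v)) • p + (μ u * μ u) • S (0,1) (0,1) - S (1,0) (1,0) := by
    rw [dw]
    have hx0 : x - M 0 * 0 = x := by simp
    have h1 : HasDerivAt (fun t => D (0, x - M t * t) (0,1)) ((-(μ u)) • S (0,1) (0,1)) 0 := by
      have h2 := HasDerivAt.scomp (0:ℝ) (by rw [hx0]; exact dDy' (0,1)) (dc 0)
      refine h2.congr_deriv ?_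
      simp [hM0]
    have h2 : HasDerivAt (fun t => -(deriv M t * t + M t)) (-(2 * fderiv ℝ μ u v)) 0 := by
      have := ((dM'.mul (hasDerivAt_id 0)).add (dM 0)).neg
      refine this.congr_deriv ?_
      simp [hM1]; ring
    have h3 := ((h2.smul h1).sub (dDt' (1,0))).deriv
    refine Eq.trans h3 ?_
    rw [hx0]
    simp only [mul_zero, zero_add, hM0, smul_smul, neg_mul_neg]
    rw [← hp]
    abel
  have heig' : fderiv ℝ l u v (K u p) + l u (fderiv ℝ K u v p) =
      fderiv ℝ μ u v * l u p + μ u * fderiv ℝ l u v p := by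
    have dc : HasDerivAt (fun s : ℝ => u + s • v) v 0 := by
      simpa using ((hasDerivAt_id (0:ℝ)).smul_const v).const_add u
    have hu0 : u + (0:ℝ) • v = u := by simp
    have h1 := HasFDerivAt.comp_hasDerivAt (0:ℝ) (by rw [hu0]; exact dl) dc
    have h2 := HasFDerivAt.comp_hasDerivAt (0:ℝ) (by rw [hu0]; exact dμ) dc
    have h3 := HasFDerivAt.comp_hasDerivAt (0:ℝ) (by rw [hu0]; exact hdK) dc
    have a := h1.clm_apply (h3.clm_apply (hasDerivAt_const 0 p))
    have b := h2.mul (h1.clm_apply (hasDerivAt_const 0 p))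
    have hab : (fun s : ℝ => (l ∘ fun s : ℝ => u + s • v) s
        ((K ∘ fun s : ℝ => u + s • v) s p)) = (fun s : ℝ => (μ ∘ fun s : ℝ => u + s • v) s *
        (l ∘ fun s : ℝ => u + s • v) s p) := funext fun s => heig _ _
    rw [hab] at a
    have := a.unique b
    simpa using this
  have hJp : K u p = -(2:ℝ) • v - μ u • p := by
    rw [hγ1]; module
  refine bigO_pair (fun t => l (γ t)) _ (hl.comp hγ) hws
    (-(μ u) • p + K u p) _ _ ?_ ?_ dw2 hL1 ?_ ?_
  · simp [hM0]
  · rw [dw]; simp [hM0, hqt, hp]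
  · simp [hγ0, heig]
  · rw [htt]
    simp only [hγ0, map_add, map_sub, map_neg, map_smul, heig, smul_eq_mul, neg_smul,
      neg_apply]
    have h1 : fderiv ℝ K u (K u p) p = -(2:ℝ) • fderiv ℝ K u v p - μ u • fderiv ℝ K u p p := by
      conv_lhs => rw [hJp]
      simp
    rw [h1]
    simp only [map_sub, map_smul, smul_eq_mul]
    linear_combination 2 * heig'

lemma proj_sum (m : ℕ) (A B : Matrix (Fin m) (Fin m) ℝ) (c : Fin m → ℝ) :
    ∑ k, c k • (A * Matrix.diagonal (Pi.single k 1) * B) = A * Matrix.diagonal c * B := by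
  ext i j
  simp [Matrix.sum_apply, Matrix.mul_apply, Matrix.diagonal_apply, Finset.sum_mul, Pi.single_apply]
  refine Finset.sum_congr rfl fun k _ => ?_
  ring

/-- The approximate evolution operator for a nonlinear hyperbolic system
`∂_t q + ∂_x f(q) = 0` built from the predictor
`q^{(i)}_β(t) = Σ_{k,α} F^{(k)}_{βα}(x) q_{α,0}(x − t(λ_i(x)+λ_k(x))/2)`,
`λ_i* = λ_i(q^{(i)})`, and the matrix `R*` whose `i`-th row is the `i`-th row of
`R(q^{(i)})`, is well defined (`R*` invertible) for small `t > 0` and approximates the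
exact smooth solution to third order: `q̃(t,x) = q(t,x) + O(t³)` as `t → 0⁺`. -/
theorem stmt_3 (m : ℕ) (T x : ℝ) (hT : 0 < T)
    (f : (Fin m → ℝ) → (Fin m → ℝ))
    (J R Rinv : (Fin m → ℝ) → Matrix (Fin m) (Fin m) ℝ)
    (lam : (Fin m → ℝ) → Fin m → ℝ)
    (hf : ContDiff ℝ (⊤ : ℕ∞) f)
    (hJ : ∀ p v, fderiv ℝ f p v = (J p).mulVec v)
    (hRsmooth : ∀ i j, ContDiff ℝ (⊤ : ℕ∞) fun p => R p i j)
    (hlamsmooth : ∀ i, ContDiff ℝ (⊤ : ℕ∞) fun p => lam p i)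
    (hRinv : ∀ p, R p * Rinv p = 1 ∧ Rinv p * R p = 1)
    (hdiag : ∀ p, R p * J p * Rinv p = Matrix.diagonal (lam p))
    (q : ℝ → ℝ → (Fin m → ℝ))
    (hq : ContDiff ℝ (⊤ : ℕ∞) fun pr : ℝ × ℝ => q pr.1 pr.2)
    (hPDE : ∀ t ∈ Set.Icc (0 : ℝ) T, ∀ y : ℝ,
      deriv (fun s => q s y) t + deriv (fun z => f (q t z)) y = 0) :
    -- the projector associated with the k-th eigenvalue, at the initial data in x
    let F : Fin m → Matrix (Fin m) (Fin m) ℝ := fun k =>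
      Rinv (q 0 x) * Matrix.diagonal (Pi.single k 1) * R (q 0 x)
    -- λ_i(x)
    let lamx : Fin m → ℝ := lam (q 0 x)
    -- the predictor q^{(i)}(t)
    let qpred : ℝ → Fin m → (Fin m → ℝ) := fun t i => fun β =>
      ∑ k, ∑ α, F k β α * q 0 (x - t * (lamx i + lamx k) / 2) α
    -- λ_i* and R*
    let lamstar : ℝ → Fin m → ℝ := fun t i => lam (qpred t i) i
    let Rstar : ℝ → Matrix (Fin m) (Fin m) ℝ := fun t =>
      Matrix.of fun i j => R (qpred t i) i j
    -- the approximate solution operator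
    let qtilde : ℝ → Fin m → ℝ := fun t ℓ =>
      ∑ i, (Rstar t)⁻¹ ℓ i * ∑ j, Rstar t i j * q 0 (x - lamstar t i * t) j
    (∀ᶠ t in 𝓝[>] (0 : ℝ), IsUnit (Rstar t)) ∧
      (fun t => (fun ℓ => qtilde t ℓ) - q t x) =O[𝓝[>] (0 : ℝ)] fun t => t ^ 3 := by
  intro F lamx qpred lamstar Rstar qtilde
  set Q : ℝ × ℝ → Fin m → ℝ := fun pr => q pr.1 pr.2 with hQdef
  have hdQ : ∀ z, HasFDerivAt Q (fderiv ℝ Q z) z :=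
    fun z => (hq.differentiable (by simp) z).hasFDerivAt
  have dt : ∀ t y, HasDerivAt (fun s => q s y) (fderiv ℝ Q (t, y) (1, 0)) t := fun t y =>
    HasFDerivAt.comp_hasDerivAt (f := fun s : ℝ => (s, y)) t (hdQ (t, y)) ((hasDerivAt_id t).prodMk (hasDerivAt_const t y))
  have dy : ∀ t y, HasDerivAt (fun s => q t s) (fderiv ℝ Q (t, y) (0, 1)) y := fun t y =>
    HasFDerivAt.comp_hasDerivAt (f := fun s : ℝ => (t, s)) y (hdQ (t, y)) ((hasDerivAt_const y t).prodMk (hasDerivAt_id y))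
  have hPDE' : ∀ t ∈ Set.Icc (0:ℝ) T, ∀ y, fderiv ℝ Q (t, y) (1, 0) =
      - fderiv ℝ f (Q (t, y)) (fderiv ℝ Q (t, y) (0, 1)) := by
    intro t ht y
    have h := hPDE t ht y
    have h2 : HasDerivAt (fun z => f (q t z))
        (fderiv ℝ f (Q (t, y)) (fderiv ℝ Q (t, y) (0, 1))) y :=
      HasFDerivAt.comp_hasDerivAt y
        ((hf.differentiable (by simp) (q t y)).hasFDerivAt) (dy t y)
    rw [(dt t y).deriv, h2.deriv] at h
    exact eq_neg_of_add_eq_zero_left h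
  set p := fderiv ℝ Q (0, x) (0, 1) with hp
  set u := q 0 x with hu
  have hF1 : ∑ k, F k = 1 := by
    have := proj_sum m (Rinv u) (R u) (fun _ => 1)
    simpa [F, (hRinv u).2] using this
  have hFl : ∑ k, lamx k • F k = J u := by
    have := proj_sum m (Rinv u) (R u) (lam u)
    refine this.trans ?_
    rw [← hdiag u]
    calc Rinv u * (R u * J u * Rinv u) * R u = (Rinv u * R u) * J u * (Rinv u * R u) := by
          simp only [Matrix.mul_assoc]
      _ = J u := by simp [(hRinv u).2]
  have hqp : ∀ t i, qpred t i = ∑ k, (F k).mulVec (q 0 (x - t * (lamx i + lamx k) / 2)) := by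
    intro t i
    ext β
    simp [qpred, Matrix.mulVec, dotProduct]
  have hqp0 : ∀ i, qpred 0 i = u := by
    intro i
    rw [hqp]
    simp only [zero_mul, zero_div, sub_zero]
    rw [← Matrix.sum_mulVec, hF1, Matrix.one_mulVec]
  have hq0c : ∀ j, ContDiff ℝ (⊤ : ℕ∞) (fun y => q 0 y j) := by
    intro j
    have h : ContDiff ℝ (⊤ : ℕ∞) (fun y : ℝ => Q (0, y)) := by fun_prop
    exact contDiff_pi.1 h j
  have hqps : ∀ i, ContDiff ℝ (⊤ : ℕ∞) (fun t => qpred t i) := by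
    intro i
    refine contDiff_pi.2 fun β => ?_
    refine ContDiff.sum fun k _ => ContDiff.sum fun α _ => contDiff_const.mul ?_
    exact (hq0c α).comp (by fun_prop)
  have hqpd : ∀ i, deriv (fun t => qpred t i) 0 =
      -(1/2 : ℝ) • (lam u i • p + fderiv ℝ f u p) := by
    intro i
    have h1 : ∀ k, HasDerivAt (fun t : ℝ => q 0 (x - t * (lamx i + lamx k) / 2))
        (-((lamx i + lamx k) / 2) • p) 0 := by
      intro k
      have hc : HasDerivAt (fun t : ℝ => x - t * (lamx i + lamx k) / 2)
          (-((lamx i + lamx k) / 2)) 0 := by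
        have := (((hasDerivAt_id (0:ℝ)).mul_const (lamx i + lamx k)).div_const 2).const_sub x
        simpa using this
      have hx0 : x - (0:ℝ) * (lamx i + lamx k) / 2 = x := by simp
      exact HasDerivAt.scomp (0:ℝ) (by rw [hx0]; exact dy 0 x) hc
    have h2 : HasDerivAt (fun t => qpred t i)
        (∑ k, (F k).mulVec (-((lamx i + lamx k) / 2) • p)) 0 := by
      simp only [hqp]
      refine HasDerivAt.fun_sum fun k _ => ?_
      exact ((F k).mulVecLin.toContinuousLinearMap.hasFDerivAt).comp_hasDerivAt (0:ℝ) (h1 k)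
    rw [h2.deriv, hJ, ← hFl]
    have h3 : lam u i • p = lamx i • (∑ k, F k).mulVec p := by rw [hF1, Matrix.one_mulVec]
    rw [h3]
    simp only [Matrix.sum_mulVec, Matrix.mulVec_smul, Matrix.smul_mulVec, Finset.smul_sum,
      ← Finset.sum_add_distrib]
    refine Finset.sum_congr rfl fun k _ => ?_
    module
  let l : Fin m → (Fin m → ℝ) → (Fin m → ℝ) →L[ℝ] ℝ := fun i p =>
    ∑ j, R p i j • (ContinuousLinearMap.proj j : (Fin m → ℝ) →L[ℝ] ℝ)
  have hl_apply : ∀ i p v, l i p v = (R p).mulVec v i := by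
    intro i p v
    simp [l, Matrix.mulVec, dotProduct]
  have hls : ∀ i, ContDiff ℝ (⊤ : ℕ∞) (l i) := fun i =>
    ContDiff.sum fun j _ => (hRsmooth i j).smul contDiff_const
  have heig : ∀ i p v, l i p (fderiv ℝ f p v) = lam p i * l i p v := by
    intro i p v
    rw [hl_apply, hl_apply, hJ, Matrix.mulVec_mulVec]
    have h : R p * J p = Matrix.diagonal (lam p) * R p := by
      rw [← hdiag p, Matrix.mul_assoc, (hRinv p).2, Matrix.mul_one]
    rw [h, ← Matrix.mulVec_mulVec, Matrix.mulVec_diagonal]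
  have hKs : ContDiff ℝ (⊤ : ℕ∞) (fderiv ℝ f) := hf.fderiv_right (by simp)
  have main : ∀ i, (fun t => l i (qpred t i) (q 0 (x - lamstar t i * t) - q t x))
      =O[𝓝 0] fun t => t ^ 3 := fun i =>
    main_abs T x hT (fderiv ℝ f) (l i) (fun p => lam p i) hKs (hls i) (hlamsmooth i) (heig i)
      Q hq hPDE' (fun t => qpred t i) (hqps i) (hqp0 i) (hqpd i)
  have hRc : Continuous Rstar := by
    refine continuous_matrix fun i j => ?_
    exact ((hRsmooth i j).comp (hqps i)).continuous
  have hR0 : Rstar 0 = R u := by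
    ext i j
    simp [Rstar, hqp0]
  have hdet0 : (Rstar 0).det ≠ 0 := by
    rw [hR0]
    intro h
    have := congrArg Matrix.det (hRinv u).1
    rw [Matrix.det_mul, h] at this
    simp at this
  have hdetc : Continuous fun t => (Rstar t).det := hRc.matrix_det
  have hdet : ∀ᶠ t in 𝓝 (0:ℝ), (Rstar t).det ≠ 0 := hdetc.continuousAt.eventually_ne hdet0
  have hunit : ∀ᶠ t in 𝓝 (0:ℝ), IsUnit (Rstar t) := by
    filter_upwards [hdet] with t ht
    exact (Matrix.isUnit_iff_isUnit_det _).2 (isUnit_iff_ne_zero.2 ht)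
  refine ⟨hunit.filter_mono nhdsWithin_le_nhds, ?_⟩
  refine IsBigO.mono ?_ nhdsWithin_le_nhds
  have hinv : ∀ a b, (fun t => (Rstar t)⁻¹ a b) =O[𝓝 0] fun _ => (1:ℝ) := by
    intro a b
    have hc : ContinuousAt (fun t => (Rstar t)⁻¹ a b) 0 := by
      have : ∀ t, (Rstar t)⁻¹ a b = ((Rstar t).det)⁻¹ * (Rstar t).adjugate a b := by
        intro t
        simp [Matrix.inv_def]
      simp only [this]
      exact (hdetc.continuousAt.inv₀ hdet0).mul
        ((hRc.matrix_adjugate.matrix_elem a b).continuousAt)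
    exact hc.isBigO_one ℝ
  rw [isBigO_pi]
  intro a
  have hsum : (fun t => ∑ i, (Rstar t)⁻¹ a i *
      l i (qpred t i) (q 0 (x - lamstar t i * t) - q t x)) =O[𝓝 0] fun t => t ^ 3 := by
    refine IsBigO.fun_sum fun i _ => ?_
    simpa using (hinv a i).mul (main i)
  refine hsum.congr' ?_ EventuallyEq.rfl
  filter_upwards [hdet] with t ht
  have hl2 : ∀ i v, l i (qpred t i) v = (Rstar t).mulVec v i := by
    intro i v
    rw [hl_apply]
    rfl
  have hq1 : q t x a = ∑ i, (Rstar t)⁻¹ a i * (Rstar t).mulVec (q t x) i := by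
    have : q t x = (Rstar t)⁻¹.mulVec ((Rstar t).mulVec (q t x)) := by
      rw [Matrix.mulVec_mulVec, Matrix.nonsing_inv_mul _ (isUnit_iff_ne_zero.2 ht),
        Matrix.one_mulVec]
    exact congrFun this a
  simp only [Pi.sub_apply, qtilde]
  rw [hq1, ← Finset.sum_sub_distrib]
  refine Finset.sum_congr rfl fun i _ => ?_
  rw [map_sub, hl2, hl2, mul_sub]
  rfl
end

section
/- In the setting of the approximate evolution operator for systems, the predictor q^{(i)}_β(t) := Σ_{k,α=1}^m F^{(k)}_{βα}(x) q_{α,0}(x − t (λ_i(x) + λ_k(x))/2) satisfies, at t = 0, d/dt q^{(i)}_β(t)|_{t=0} = −(1/2) λ_i(x) q′_{β,0}(x) − (1/2) Σ_{α=1}^m J_{βα}(q₀(x)) q′_{α,0}(x), where the prime denotes differentiation of the initial data q₀ with respect to its argument. -/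
/-- Time derivative of the predictor at `t = 0`:
`d/dt q^{(i)}_β(t)|_{t=0} = −½ λ_i(x) q′_{β,0}(x) − ½ Σ_α J_{βα}(q₀(x)) q′_{α,0}(x)`. -/
theorem stmt_5 (m : ℕ) (x : ℝ)
    (f : (Fin m → ℝ) → (Fin m → ℝ))
    (J R Rinv : (Fin m → ℝ) → Matrix (Fin m) (Fin m) ℝ)
    (lam : (Fin m → ℝ) → Fin m → ℝ)
    (hf : ContDiff ℝ (⊤ : ℕ∞) f)
    (hJ : ∀ p v, fderiv ℝ f p v = (J p).mulVec v)
    (hRsmooth : ∀ i j, ContDiff ℝ (⊤ : ℕ∞) fun p => R p i j)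
    (hlamsmooth : ∀ i, ContDiff ℝ (⊤ : ℕ∞) fun p => lam p i)
    (hRinv : ∀ p, R p * Rinv p = 1 ∧ Rinv p * R p = 1)
    (hdiag : ∀ p, R p * J p * Rinv p = Matrix.diagonal (lam p))
    (q₀ : ℝ → Fin m → ℝ)
    (hq₀ : ContDiff ℝ (⊤ : ℕ∞) q₀) :
    -- the projector associated with the k-th eigenvalue, at the initial data in x
    let F : Fin m → Matrix (Fin m) (Fin m) ℝ := fun k =>
      Rinv (q₀ x) * Matrix.diagonal (Pi.single k 1) * R (q₀ x)
    ∀ (i β : Fin m),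
      deriv (fun t : ℝ =>
          ∑ k, ∑ α, F k β α * q₀ (x - t * (lam (q₀ x) i + lam (q₀ x) k) / 2) α) 0
        = -(1 / 2) * lam (q₀ x) i * deriv (fun y => q₀ y β) x
          - (1 / 2) * ∑ α, J (q₀ x) β α * deriv (fun y => q₀ y α) x := by
  intro F i β
  have hF : ∀ k α, F k β α = Rinv (q₀ x) β k * R (q₀ x) k α := by
    intro k α
    simp only [F]
    rw [Matrix.mul_apply, Finset.sum_eq_single k]
    · rw [Matrix.mul_diagonal]; simp
    · intro b _ hb
      rw [Matrix.mul_diagonal]; simp [hb]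
    · simp
  have h1 : ∀ α, ∑ k, F k β α = (1 : Matrix (Fin m) (Fin m) ℝ) β α := by
    intro α
    rw [← (hRinv (q₀ x)).2, Matrix.mul_apply]
    exact Finset.sum_congr rfl fun k _ => hF k α
  have hJe : J (q₀ x) = Rinv (q₀ x) * Matrix.diagonal (lam (q₀ x)) * R (q₀ x) := by
    rw [← hdiag]
    have h2 := (hRinv (q₀ x)).2
    calc J (q₀ x) = (Rinv (q₀ x) * R (q₀ x)) * J (q₀ x) * (Rinv (q₀ x) * R (q₀ x)) := by
          rw [h2]; simp
      _ = _ := by simp only [Matrix.mul_assoc]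
  have h2 : ∀ α, ∑ k, lam (q₀ x) k * F k β α = J (q₀ x) β α := by
    intro α
    rw [hJe, Matrix.mul_apply]
    refine Finset.sum_congr rfl fun k _ => ?_
    rw [hF, Matrix.mul_diagonal]; ring
  have hd : ∀ α, HasDerivAt (fun y => q₀ y α) (deriv (fun y => q₀ y α) x) x := by
    intro α
    have h := (contDiff_pi.1 hq₀ α).differentiable (by simp)
    exact (h x).hasDerivAt
  have hder : HasDerivAt (fun t : ℝ =>
      ∑ k, ∑ α, F k β α * q₀ (x - t * (lam (q₀ x) i + lam (q₀ x) k) / 2) α)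
      (∑ k, ∑ α, F k β α * (deriv (fun y => q₀ y α) x *
        (-((lam (q₀ x) i + lam (q₀ x) k) / 2)))) 0 := by
    refine HasDerivAt.fun_sum fun k _ => HasDerivAt.fun_sum fun α _ =>
      HasDerivAt.const_mul _ ?_
    have hin : HasDerivAt (fun t : ℝ => x - t * (lam (q₀ x) i + lam (q₀ x) k) / 2)
        (-((lam (q₀ x) i + lam (q₀ x) k) / 2)) 0 := by
      have := (((hasDerivAt_id (0 : ℝ)).mul_const
        (lam (q₀ x) i + lam (q₀ x) k)).div_const 2).const_sub x
      simpa using this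
    have hx : HasDerivAt (fun y => q₀ y α) (deriv (fun y => q₀ y α) x)
        (x - (0 : ℝ) * (lam (q₀ x) i + lam (q₀ x) k) / 2) := by
      simpa using hd α
    exact hx.comp (0 : ℝ) hin
  rw [hder.deriv, Finset.sum_comm]
  have h3 : ∀ α, ∑ k, F k β α * (deriv (fun y => q₀ y α) x *
        (-((lam (q₀ x) i + lam (q₀ x) k) / 2))) =
      -(1 / 2) * lam (q₀ x) i * ((1 : Matrix (Fin m) (Fin m) ℝ) β α * deriv (fun y => q₀ y α) x)
        - (1 / 2) * (J (q₀ x) β α * deriv (fun y => q₀ y α) x) := by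
    intro α
    rw [← h1, ← h2, Finset.sum_mul, Finset.sum_mul, Finset.mul_sum, Finset.mul_sum,
      ← Finset.sum_sub_distrib]
    exact Finset.sum_congr rfl fun k _ => by ring
  rw [Finset.sum_congr rfl fun α _ => h3 α, Finset.sum_sub_distrib, ← Finset.mul_sum,
    ← Finset.mul_sum]
  simp [Matrix.one_apply]
end

section
/- Consider the isentropic/full Euler framework in the variables (ρ, v, p) with γ > 1 and sound speed c = √(γ p / ρ), with diagonalization matrix R whose rows are R_{+,·} = (0, 1, c/(γp)), R_{0,·} = (−γ p ρ^{−γ−1}, 0, ρ^{−γ}), R_{−,·} = (0, −1, c/(γp)) and eigenvalues λ₊ = v + c, λ₀ = v, λ₋ = v − c. Let the initial data have constant velocity v and constant pressure p > 0 and a smooth positive density profile ρ : ℝ → ℝ (a contact wave). Then the approximate evolution operator q̃(t,x) — defined by the predictor q^{(i)}_β := Σ_{k,α} F^{(k)}_{βα}(x) q_{α,0}(x − t(λ_i(x)+λ_k(x))/2) with F^{(k)} = R⁻¹ diag(0,…,1,…,0) R, λ_i* := λ_i(q^{(i)}), R* the matrix whose i-th row is the i-th row of R(q^{(i)}), and q̃_ℓ(t,x)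 := Σ_{i,j} (R*)⁻¹_{ℓi} R*_{ij} q_{j,0}(x − λ_i* t) — is exact: q̃(t,x) = (ρ(x − v t), v, p) for all t ≥ 0 for which the construction is defined. -/
open scoped Matrix

/-- Sound speed `c = √(γ p / ρ)` of a state `q = (ρ, v, p)`. -/
noncomputable def eulerC (γ : ℝ) (q : Fin 3 → ℝ) : ℝ :=
  Real.sqrt (γ * q 2 / q 0)

/-- The transformation matrix `R` from `(ρ, v, p)` to the eigenspace `(+, 0, −)`:
rows `(0, 1, c/(γp))`, `(−γ p ρ^{−γ−1}, 0, ρ^{−γ})`, `(0, −1, c/(γp))`. -/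
noncomputable def eulerR (γ : ℝ) (q : Fin 3 → ℝ) : Matrix (Fin 3) (Fin 3) ℝ :=
  !![0, 1, eulerC γ q / (γ * q 2);
     -γ * q 2 * q 0 ^ (-γ - 1), 0, q 0 ^ (-γ : ℝ);
     0, -1, eulerC γ q / (γ * q 2)]

/-- The eigenvalues `λ₊ = v + c`, `λ₀ = v`, `λ₋ = v − c`. -/
noncomputable def eulerLam (γ : ℝ) (q : Fin 3 → ℝ) : Fin 3 → ℝ :=
  ![q 1 + eulerC γ q, q 1, q 1 - eulerC γ q]

/-- The projector `F^{(k)} = R⁻¹ diag(0,…,1,…,0) R` associated with the k-th eigenvalue. -/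
noncomputable def eulerF (γ : ℝ) (q : Fin 3 → ℝ) (k : Fin 3) : Matrix (Fin 3) (Fin 3) ℝ :=
  (eulerR γ q)⁻¹ * Matrix.diagonal (Pi.single k 1) * eulerR γ q

theorem aux_recover (M : Matrix (Fin 3) (Fin 3) ℝ) (hM : IsUnit M) (h0 : M 0 0 = 0)
    (h2 : M 2 0 = 0) (f : Fin 3 → ℝ) (v p : ℝ) (l : Fin 3) :
    ∑ i, M⁻¹ l i * ∑ j, M i j * (![f i, v, p] : Fin 3 → ℝ) j
      = (![f 1, v, p] : Fin 3 → ℝ) l := by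
  have h : ∀ i, ∑ j, M i j * (![f i, v, p] : Fin 3 → ℝ) j
      = (M *ᵥ ![f 1, v, p]) i := by
    intro i
    fin_cases i <;> simp [Matrix.mulVec, dotProduct, Fin.sum_univ_three, h0, h2]
  simp_rw [h]
  change (M⁻¹ *ᵥ (M *ᵥ ![f 1, v, p])) l = _
  rw [Matrix.mulVec_mulVec, Matrix.nonsing_inv_mul _ ((Matrix.isUnit_iff_isUnit_det _).1 hM),
    Matrix.one_mulVec]

theorem aux_unit (γ v p r : ℝ) (hγ : 1 < γ) (hp : 0 < p) (hr : 0 < r) :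
    IsUnit (eulerR γ ![r, v, p]) := by
  rw [Matrix.isUnit_iff_isUnit_det, isUnit_iff_ne_zero]
  have hc : 0 < eulerC γ ![r, v, p] := by
    unfold eulerC
    apply Real.sqrt_pos.2
    simp
    positivity
  have hd : (eulerR γ ![r, v, p]).det
      = 2 * (γ * p * r ^ (-γ - 1)) * (eulerC γ ![r, v, p] / (γ * p)) := by
    simp [eulerR, Matrix.det_fin_three]
    ring
  rw [hd]
  have := Real.rpow_pos_of_pos hr (-γ - 1)
  positivity

theorem aux_F (γ : ℝ) (q : Fin 3 → ℝ) (k b a : Fin 3) :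
    eulerF γ q k b a = (eulerR γ q)⁻¹ b k * eulerR γ q k a := by
  unfold eulerF
  rw [Matrix.mul_apply]
  simp [Matrix.mul_diagonal, Pi.single_apply]

/-- On a contact wave (constant velocity `v` and pressure `p`, smooth positive density `ρ`),
the approximate evolution operator of the Active Flux scheme is exact:
`q̃(t, x) = (ρ(x − v t), v, p)` whenever the construction is defined (`R*` invertible). -/
theorem stmt_7 (γ v p x : ℝ) (hγ : 1 < γ) (hp : 0 < p)
    (ρ : ℝ → ℝ) (hρ : ContDiff ℝ (⊤ : ℕ∞) ρ) (hρpos : ∀ y, 0 < ρ y) :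
    -- initial data: a contact wave
    let q0 : ℝ → Fin 3 → ℝ := fun y => ![ρ y, v, p]
    -- λ_i(x)
    let lamx : Fin 3 → ℝ := eulerLam γ (q0 x)
    -- the predictor q^{(i)}(t)
    let qpred : ℝ → Fin 3 → (Fin 3 → ℝ) := fun t i => fun β =>
      ∑ k, ∑ α, eulerF γ (q0 x) k β α * q0 (x - t * (lamx i + lamx k) / 2) α
    -- λ_i* and R* (whose i-th row is the i-th row of R(q^{(i)}))
    let lamstar : ℝ → Fin 3 → ℝ := fun t i => eulerLam γ (qpred t i) i
    let Rstar : ℝ → Matrix (Fin 3) (Fin 3) ℝ := fun t =>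
      Matrix.of fun i j => eulerR γ (qpred t i) i j
    -- the approximate solution operator
    let qtilde : ℝ → Fin 3 → ℝ := fun t ℓ =>
      ∑ i, (Rstar t)⁻¹ ℓ i * ∑ j, Rstar t i j * q0 (x - lamstar t i * t) j
    ∀ t : ℝ, 0 ≤ t → IsUnit (Rstar t) →
      (fun ℓ => qtilde t ℓ) = ![ρ (x - v * t), v, p] := by
  intro q0 lamx qpred lamstar Rstar qtilde t ht hU
  have hq : ∀ i, qpred t i = ![ρ (x - t * (lamx i + lamx 1) / 2), v, p] := by
    intro i
    funext b
    have := aux_recover (eulerR γ (q0 x)) (aux_unit γ v p (ρ x) hγ hp (hρpos x))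
      (by simp [eulerR]) (by simp [eulerR])
      (fun k => ρ (x - t * (lamx i + lamx k) / 2)) v p b
    rw [← this]
    simp only [qpred, aux_F, Finset.mul_sum, mul_assoc]
    rfl
  have hl : lamstar t 1 = v := by
    simp only [lamstar, hq]
    simp [eulerLam]
  funext l
  have := aux_recover (Rstar t) hU (by simp [Rstar, eulerR]) (by simp [Rstar, eulerR])
    (fun i => ρ (x - lamstar t i * t)) v p l
  simp only [hl] at this
  exact this
end

section
/- Let Q : [0,T] × ℝ → ℝ^m be a smooth solution of the diagonal system ∂_t Q_i + λ_i(Q₁, …, Q_m) ∂_x Q_i = 0 (i = 1, …, m) with smooth λ_i : ℝ^m → ℝ, and set Q_{i,0}(x) := Q_i(0, x). Fix x and abbreviate λ_i(x) := λ_i(Q_{1,0}(x), …, Q_{m,0}(x)). Define the predictor footpoints ξ̂*_{ij} := x − t (λ_i(x) + λ_j(x))/2 for i, j = 1, …, m, and then ξ̂_i := x − t λ_i(Q_{1,0}(ξ̂*_{i1}), …, Q_{m,0}(ξ̂*_{im})). Then Q_{i,0}(ξ̂_i) = Q_i(t, x) + O(t³) as t → 0⁺, for each i. -/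
open Asymptotics Filter Topology

lemma two_le_inf : (2 : WithTop ℕ∞) ≤ ((⊤ : ℕ∞) : WithTop ℕ∞) := by
  have : ((2 : ℕ∞) : WithTop ℕ∞) ≤ ((⊤ : ℕ∞) : WithTop ℕ∞) := WithTop.coe_le_coe.2 le_top
  exact this

lemma bigO_step_s8 (F F' : ℝ → ℝ) (n : ℕ) (h0 : F 0 = 0) (hd : ∀ t, HasDerivAt F (F' t) t)
    (hO : F' =O[𝓝[>] (0:ℝ)] fun t => t ^ n) : F =O[𝓝[>] (0:ℝ)] fun t => t ^ (n+1) := by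
  obtain ⟨C, hC⟩ := hO.bound
  obtain ⟨e, he, hE⟩ := mem_nhdsGT_iff_exists_Ioo_subset.1 hC
  refine IsBigO.of_bound C ?_
  filter_upwards [Ioo_mem_nhdsGT he] with t ht
  obtain ⟨c, hc, hcc⟩ := exists_hasDerivAt_eq_slope F F' ht.1
    (fun s _ => (hd s).continuousAt.continuousWithinAt) (fun s _ => hd s)
  have h1 : ‖F' c‖ ≤ C * ‖c ^ n‖ := hE ⟨hc.1, hc.2.trans ht.2⟩
  have h2 : F t = F' c * t := by
    rw [hcc, h0]; have := ht.1.ne'; field_simp; simp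
  have hC0 : 0 ≤ C := by
    by_contra h
    have : 0 < ‖c ^ n‖ := norm_pos_iff.2 (pow_ne_zero _ hc.1.ne')
    nlinarith [norm_nonneg (F' c)]
  have h3 : ‖c ^ n‖ ≤ ‖t ^ n‖ := by
    rw [norm_pow, norm_pow]
    gcongr
    rw [Real.norm_of_nonneg hc.1.le, Real.norm_of_nonneg ht.1.le]; exact hc.2.le
  rw [h2, norm_mul, pow_succ, norm_mul, ← mul_assoc]
  gcongr
  exact h1.trans (by gcongr)

lemma bigO_three_s8 (F F' : ℝ → ℝ) (hF' : ContDiff ℝ 2 F') (h0 : F 0 = 0)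
    (hd : ∀ t, HasDerivAt F (F' t) t) (h1 : F' 0 = 0)
    (h2 : HasDerivWithinAt F' 0 (Set.Ici 0) 0) : F =O[𝓝[>] (0:ℝ)] fun t => t ^ 3 := by
  have hdF' : ∀ t, HasDerivAt F' (deriv F' t) t := fun t =>
    (hF'.differentiable (by norm_num) t).hasDerivAt
  have h20 : deriv F' 0 = 0 :=
    (uniqueDiffOn_Ici (0:ℝ) 0 (by simp)).eq_deriv _ (hdF' 0).hasDerivWithinAt h2
  refine bigO_step_s8 F F' 2 h0 hd (bigO_step_s8 F' (deriv F') 1 h1 hdF' ?_)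
  have h3 : DifferentiableAt ℝ (deriv F') 0 := by
    have : ContDiff ℝ 1 (deriv F') := by
      have := (contDiff_succ_iff_deriv (n := 1) (f := F')).1 (by simpa [one_add_one_eq_two] using hF')
      exact this.2.2
    exact this.differentiable (by norm_num) 0
  have := h3.hasDerivAt.isBigO_sub
  simp only [h20, sub_zero] at this
  simpa using this.mono nhdsWithin_le_nhds

lemma partials (P : ℝ × ℝ → ℝ) (hP : ContDiff ℝ (⊤ : ℕ∞) P) :
    ∃ Pt Px : ℝ × ℝ → ℝ, ContDiff ℝ (⊤ : ℕ∞) Pt ∧ ContDiff ℝ (⊤ : ℕ∞) Px ∧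
      (∀ t y, HasDerivAt (fun s => P (s, y)) (Pt (t, y)) t) ∧
      (∀ t y, HasDerivAt (fun z => P (t, z)) (Px (t, y)) y) ∧
      (∀ t y d, HasDerivAt (fun z => Pt (t, z)) d y → HasDerivAt (fun s => Px (s, y)) d t) := by
  have hD : ContDiff ℝ (⊤ : ℕ∞) (fderiv ℝ P) := hP.fderiv_right (by simp)
  have e1 : ∀ t y : ℝ, HasDerivAt (fun s : ℝ => (s, y)) ((1:ℝ), (0:ℝ)) t := fun t y =>
    (hasDerivAt_id t).prodMk (hasDerivAt_const t y)
  have e2 : ∀ t y : ℝ, HasDerivAt (fun s : ℝ => (t, s)) ((0:ℝ), (1:ℝ)) y := fun t y =>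
    (hasDerivAt_const y t).prodMk (hasDerivAt_id y)
  have hPd : ∀ p, HasFDerivAt P (fderiv ℝ P p) p := fun p =>
    (hP.differentiable (by simp) p).hasFDerivAt
  have hDd : ∀ p, HasFDerivAt (fderiv ℝ P) (fderiv ℝ (fderiv ℝ P) p) p := fun p =>
    (hD.differentiable (by simp) p).hasFDerivAt
  refine ⟨fun p => fderiv ℝ P p (1, 0), fun p => fderiv ℝ P p (0, 1), by fun_prop, by fun_prop,
    fun t y => (hPd (t, y)).comp_hasDerivAt t (e1 t y),
    fun t y => (hPd (t, y)).comp_hasDerivAt y (e2 t y), ?_⟩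
  intro t y d hd
  have a1 : HasDerivAt (fun z => fderiv ℝ P (t, z) (1, 0))
      (fderiv ℝ (fderiv ℝ P) (t, y) (0, 1) (1, 0)) y := by
    have h := (hDd (t, y)).comp_hasDerivAt y (e2 t y)
    exact (ContinuousLinearMap.apply ℝ ℝ ((1:ℝ), (0:ℝ))).hasFDerivAt.comp_hasDerivAt y h
  have a2 : HasDerivAt (fun z => fderiv ℝ P (z, y) (0, 1))
      (fderiv ℝ (fderiv ℝ P) (t, y) (1, 0) (0, 1)) t := by
    have h := (hDd (t, y)).comp_hasDerivAt t (e1 t y)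
    exact (ContinuousLinearMap.apply ℝ ℝ ((0:ℝ), (1:ℝ))).hasFDerivAt.comp_hasDerivAt t h
  have hs : IsSymmSndFDerivAt ℝ P (t, y) :=
    hP.contDiffAt.isSymmSndFDerivAt (by simpa using two_le_inf)
  rw [hd.unique a1, hs.eq]
  exact a2

/-- For a smooth solution of the diagonal system `∂_t Q_i + λ_i(Q) ∂_x Q_i = 0`, the
predictor footpoints `ξ̂*_{ij} = x − t(λ_i(x)+λ_j(x))/2` and
`ξ̂_i = x − t λ_i(Q_{1,0}(ξ̂*_{i1}),…,Q_{m,0}(ξ̂*_{im}))` give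
`Q_{i,0}(ξ̂_i) = Q_i(t,x) + O(t³)` as `t → 0⁺`. -/
theorem stmt_8 (m : ℕ) (T x : ℝ) (hT : 0 < T)
    (lam : (Fin m → ℝ) → Fin m → ℝ)
    (hlam : ∀ i, ContDiff ℝ (⊤ : ℕ∞) fun p => lam p i)
    (Q : ℝ → ℝ → (Fin m → ℝ))
    (hQ : ContDiff ℝ (⊤ : ℕ∞) fun pr : ℝ × ℝ => Q pr.1 pr.2)
    (hPDE : ∀ t ∈ Set.Icc (0 : ℝ) T, ∀ (y : ℝ) (i : Fin m),
      deriv (fun s => Q s y i) t + lam (Q t y) i * deriv (fun z => Q t z i) y = 0) :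
    -- Q_{·,0} is the initial data, λ_i(x) its eigenvalue at x
    let Q0 : ℝ → Fin m → ℝ := Q 0
    let lamx : Fin m → ℝ := lam (Q0 x)
    -- predictor footpoints ξ̂*_{ij} and corrected footpoints ξ̂_i
    let ξstar : ℝ → Fin m → Fin m → ℝ := fun t i j => x - t * (lamx i + lamx j) / 2
    let ξhat : ℝ → Fin m → ℝ := fun t i =>
      x - t * lam (fun j => Q0 (ξstar t i j) j) i
    ∀ i : Fin m,
      (fun t => Q0 (ξhat t i) i - Q t x i) =O[𝓝[>] (0 : ℝ)] fun t => t ^ 3 := by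
  intro Q0 lamx ξstar ξhat i
  have hQj : ∀ j, ContDiff ℝ (⊤ : ℕ∞) (fun pr : ℝ × ℝ => Q pr.1 pr.2 j) := fun j =>
    contDiff_pi.1 hQ j
  choose Pt Px hPt hPx dt dx dm using fun j => partials _ (hQj j)
  have pde : ∀ t ∈ Set.Icc (0 : ℝ) T, ∀ y j, Pt j (t, y) = -(lam (Q t y) j * Px j (t, y)) := by
    intro t ht y j
    have h := hPDE t ht y j
    have h1 := (dt j t y).deriv
    have h2 := (dx j t y).deriv
    simp only at h1 h2
    rw [h1, h2] at h
    linarith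
  have h0T : (0:ℝ) ∈ Set.Icc (0:ℝ) T := ⟨le_rfl, hT.le⟩
  set L := fderiv ℝ (fun p => lam p i) (Q 0 x) with hL
  have hLd : HasFDerivAt (fun p => lam p i) L (Q 0 x) :=
    ((hlam i).differentiable (by simp) _).hasFDerivAt
  set a : Fin m → ℝ := fun j => Px j (0, x) with ha
  set c : Fin m → ℝ := fun j => -(lamx j * a j) with hc
  -- derivative of `Px i` along `x`
  obtain ⟨b, hb⟩ : ∃ b, HasDerivAt (fun z => Px i (0, z)) b x := by
    have h : ContDiff ℝ (⊤ : ℕ∞) (fun z => Px i ((0:ℝ), z)) := (hPx i).comp (by fun_prop)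
    exact ⟨_, (h.differentiable (by simp) x).hasDerivAt⟩
  have hlt : HasDerivAt (fun t => lam (Q t x) i) (L c) 0 := by
    have h : HasDerivAt (fun t => Q t x) c 0 := by
      rw [hasDerivAt_pi]
      intro j
      have h := dt j 0 x
      rw [pde 0 h0T] at h
      exact h
    exact hLd.comp_hasDerivAt (0:ℝ) h
  have hlx : HasDerivAt (fun y => lam (Q 0 y) i) (L a) x := by
    have h : HasDerivAt (fun y => Q 0 y) a x := by
      rw [hasDerivAt_pi]
      intro j
      exact dx j 0 x
    exact hLd.comp_hasDerivAt x h
  have hPxt : HasDerivAt (fun t => Px i (t, x)) (-(L a * a i + lamx i * b)) 0 := by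
    apply dm i
    have h := (hlx.mul hb).neg
    refine h.congr_of_eventuallyEq (Eventually.of_forall fun z => ?_)
    simpa using pde 0 h0T z i
  have hg : HasDerivWithinAt (fun t => Pt i (t, x))
      (-(L c * a i + lamx i * (-(L a * a i + lamx i * b)))) (Set.Ici 0) 0 := by
    have h := ((hlt.mul hPxt).neg).hasDerivWithinAt (s := Set.Ici 0)
    refine h.congr_of_eventuallyEq ?_ (by simpa using pde 0 h0T x i)
    filter_upwards [Icc_mem_nhdsGE hT] with t ht
    simpa using pde t ht x i
  -- the numerical side
  set Lam : ℝ → ℝ := fun t => lam (fun j => Q 0 (ξstar t i j) j) i with hLam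
  have hLamS : ContDiff ℝ (⊤ : ℕ∞) Lam := by
    refine (hlam i).comp (contDiff_pi.2 fun j => ?_)
    have h : ContDiff ℝ (⊤ : ℕ∞) (fun t : ℝ => ((0:ℝ), ξstar t i j)) := by
      simp only [ξstar]; fun_prop
    exact (hQj j).comp h
  have hξ0 : ∀ j, ξstar 0 i j = x := fun j => by simp [ξstar]
  have hLam0 : Lam 0 = lamx i := by simp [hLam, hξ0, lamx, Q0]
  have hLam1 : HasDerivAt Lam (L (fun j => a j * (-((lamx i + lamx j) / 2)))) 0 := by
    have h : HasDerivAt (fun t => fun j => Q 0 (ξstar t i j) j)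
        (fun j => a j * (-((lamx i + lamx j) / 2))) 0 := by
      rw [hasDerivAt_pi]
      intro j
      have h1 : HasDerivAt (fun t => ξstar t i j) (-((lamx i + lamx j) / 2)) 0 := by
        have := (((hasDerivAt_id (0:ℝ)).mul_const (lamx i + lamx j)).div_const 2).const_sub x
        simpa [ξstar] using this
      have h2 := dx j 0 (ξstar 0 i j)
      have h3 := h2.comp (0:ℝ) h1
      rw [hξ0] at h3
      exact h3
    have hLd' : HasFDerivAt (fun p => lam p i) L (fun j => Q 0 (ξstar 0 i j) j) := by
      simp only [hξ0]; exact hLd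
    exact hLd'.comp_hasDerivAt (0:ℝ) h
  have hLamd : ∀ t, HasDerivAt Lam (deriv Lam t) t := fun t =>
    (hLamS.differentiable (by simp) t).hasDerivAt
  have hdLamS : ContDiff ℝ (⊤ : ℕ∞) (deriv Lam) := (contDiff_infty_iff_deriv.1 hLamS).2
  have hx1 : ∀ t, HasDerivAt (fun t => x - t * Lam t) (-(Lam t + t * deriv Lam t)) t := by
    intro t
    have := ((hasDerivAt_id t).mul (hLamd t)).const_sub x
    simpa using this
  have hN : ∀ t, HasDerivAt (fun t => Q 0 (x - t * Lam t) i)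
      (Px i (0, x - t * Lam t) * (-(Lam t + t * deriv Lam t))) t := by
    intro t
    have h := (dx i 0 (x - t * Lam t)).comp t (hx1 t)
    exact h
  have hcomb : L (fun j => a j * (-((lamx i + lamx j) / 2)))
      = -(lamx i / 2) * L a + (1/2) * L c := by
    rw [← smul_eq_mul, ← smul_eq_mul, ← map_smul, ← map_smul, ← map_add]
    congr 1
    ext j
    simp [hc]
    ring
  have hN2 : HasDerivAt (fun t => Px i (0, x - t * Lam t) * (-(Lam t + t * deriv Lam t)))
      (b * (-lamx i) * (-lamx i) + a i * (-(2 * (-(lamx i / 2) * L a + (1/2) * L c)))) 0 := by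
    have h1 : HasDerivAt (fun t => Px i (0, x - t * Lam t)) (b * (-lamx i)) 0 := by
      have hb' : HasDerivAt (fun z => Px i (0, z)) b (x - 0 * Lam 0) := by simpa using hb
      have := hb'.comp (0:ℝ) (hx1 0)
      simpa [hLam0, Function.comp_def] using this
    have h2 : HasDerivAt (fun t => t * deriv Lam t) (deriv Lam 0) 0 := by
      have := (hasDerivAt_id (0:ℝ)).mul (hdLamS.differentiable (by simp) 0).hasDerivAt
      exact this.congr_deriv (by simp)
    have h3 := h1.mul ((hLamd 0).add h2).neg
    refine h3.congr_deriv ?_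
    have hai : a i = Px i (0, x) := rfl
    rw [hLam1.deriv, hcomb, hai]
    simp only [Pi.add_apply, Pi.neg_apply, hLam0, zero_mul, sub_zero]
    ring
  refine bigO_three_s8 _ (fun t => Px i (0, x - t * Lam t) * (-(Lam t + t * deriv Lam t))
    - Pt i (t, x)) ?_ ?_ (fun t => (hN t).sub (dt i t x)) ?_ ?_
  · have h1 : ContDiff ℝ (⊤ : ℕ∞) (fun t => Px i (0, x - t * Lam t)) :=
      (hPx i).comp (by fun_prop)
    have h2 : ContDiff ℝ (⊤ : ℕ∞) (fun t => Pt i (t, x)) :=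
      (hPt i).comp (by fun_prop)
    have h3 : ContDiff ℝ (⊤ : ℕ∞) (fun t => Px i (0, x - t * Lam t) *
      (-(Lam t + t * deriv Lam t)) - Pt i (t, x)) := by fun_prop
    exact h3.of_le two_le_inf
  · simp [ξhat, Q0]
  · have := pde 0 h0T x i
    simp only [this, hLam0, zero_mul, sub_zero, add_zero, lamx, Q0]
    ring
  · have h := hN2.hasDerivWithinAt.sub hg
    refine h.congr_deriv ?_
    ring
end

section
/- Let Q = (Q₁, Q₂) : [0,T] × ℝ → ℝ² be a smooth solution of the diagonal 2×2 system ∂_t Q_i + λ_i(Q₁, Q₂) ∂_x Q_i = 0 (i = 1, 2) with smooth λ₁, λ₂ : ℝ² → ℝ, and set Q_{i,0}(x) := Q_i(0, x). Fix x and α ∈ (0, 1]. Define the predictors ξ̂_i* := x − α t λ_i(Q_{1,0}(x), Q_{2,0}(x)) for i = 1, 2; then λ_i* := λ_i( Q_{1,0}(ξ̂_i* − α t λ₁(Q_{1,0}(ξ̂_i*), Q_{2,0}(ξ̂_i*))), Q_{2,0}(ξ̂_i* − α t λ₂(Q_{1,0}(ξ̂_i*), Q_{2,0}(ξ̂_i*)))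 ); and finally ξ̂_i := x − t (1 − 1/(2α)) λ_i(Q_{1,0}(x), Q_{2,0}(x)) − t λ_i*/(2α). Then (Q_{1,0}(ξ̂₁), Q_{2,0}(ξ̂₂)) approximates (Q₁(t,x), Q₂(t,x)) with error O(t³) as t → 0⁺. -/
open Asymptotics Filter Topology

theorem aux_step (F : ℝ → ℝ) (hF : Differentiable ℝ F) (h0 : F 0 = 0) (k : ℕ)
    (h : (deriv F) =O[𝓝[>] (0 : ℝ)] fun t => t ^ k) :
    F =O[𝓝[>] (0 : ℝ)] fun t => t ^ (k + 1) := by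
  obtain ⟨C, hC⟩ := h.bound
  obtain ⟨δ, hδ, hb⟩ := (mem_nhdsGT_iff_exists_Ioo_subset).1 hC
  refine IsBigO.of_bound C ?_
  filter_upwards [Ioo_mem_nhdsGT (show (0 : ℝ) < δ from hδ)] with t ht
  obtain ⟨c, hc, hc'⟩ := exists_deriv_eq_slope F ht.1 hF.continuous.continuousOn
    hF.differentiableOn
  have h1 : ‖deriv F c‖ ≤ C * ‖c ^ k‖ := hb ⟨hc.1, hc.2.trans ht.2⟩
  have hC0 : 0 ≤ C := by
    by_contra hneg
    have : 0 < ‖c ^ k‖ := norm_pos_iff.2 (pow_ne_zero _ hc.1.ne')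
    nlinarith [norm_nonneg (deriv F c)]
  have h2 : F t = deriv F c * t := by
    rw [hc', h0]; field_simp [ht.1.ne']; ring
  have h3 : ‖c ^ k‖ ≤ ‖t ^ k‖ := by
    rw [norm_pow, norm_pow, Real.norm_of_nonneg hc.1.le, Real.norm_of_nonneg ht.1.le]
    exact pow_le_pow_left₀ hc.1.le hc.2.le k
  rw [h2, norm_mul, pow_succ, norm_mul, ← mul_assoc]
  gcongr
  exact h1.trans (by gcongr)

theorem aux_taylor (F : ℝ → ℝ) (hF : ContDiff ℝ (⊤ : ℕ∞) F) (h0 : F 0 = 0)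
    (h1 : deriv F 0 = 0) (h2 : deriv (deriv F) 0 = 0) :
    F =O[𝓝[>] (0 : ℝ)] fun t => t ^ 3 := by
  have d1 : ContDiff ℝ (⊤ : ℕ∞) (deriv F) := (contDiff_infty_iff_deriv.1 hF).2
  have d2 : ContDiff ℝ (⊤ : ℕ∞) (deriv (deriv F)) := (contDiff_infty_iff_deriv.1 d1).2
  have d3 : ContDiff ℝ (⊤ : ℕ∞) (deriv (deriv (deriv F))) := (contDiff_infty_iff_deriv.1 d2).2
  refine aux_step F (hF.differentiable (by simp)) h0 2 ?_
  refine aux_step _ (d1.differentiable (by simp)) h1 1 ?_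
  refine aux_step _ (d2.differentiable (by simp)) h2 0 ?_
  simp only [pow_zero]
  exact (d3.continuous.continuousAt.tendsto.mono_left nhdsWithin_le_nhds).isBigO_one ℝ

theorem aux_pt (G : ℝ × ℝ → ℝ) (hG : ContDiff ℝ (⊤ : ℕ∞) G) (t y : ℝ) :
    HasDerivAt (fun s => G (s, y)) (fderiv ℝ G (t, y) (1, 0)) t :=
  ((hG.differentiable (by simp)) (t, y)).hasFDerivAt.comp_hasDerivAt t
    ((hasDerivAt_id t).prodMk (hasDerivAt_const t y))

theorem aux_px (G : ℝ × ℝ → ℝ) (hG : ContDiff ℝ (⊤ : ℕ∞) G) (t y : ℝ) :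
    HasDerivAt (fun s => G (t, s)) (fderiv ℝ G (t, y) (0, 1)) y :=
  ((hG.differentiable (by simp)) (t, y)).hasFDerivAt.comp_hasDerivAt y
    ((hasDerivAt_const y t).prodMk (hasDerivAt_id y))

theorem aux_smooth (G : ℝ × ℝ → ℝ) (hG : ContDiff ℝ (⊤ : ℕ∞) G) (v : ℝ × ℝ) :
    ContDiff ℝ (⊤ : ℕ∞) (fun z => fderiv ℝ G z v) :=
  (hG.fderiv_right (by simp)).clm_apply contDiff_const

theorem aux_symm (G : ℝ × ℝ → ℝ) (hG : ContDiff ℝ (⊤ : ℕ∞) G) (v w z : ℝ × ℝ) :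
    fderiv ℝ (fun z => fderiv ℝ G z v) z w = fderiv ℝ (fun z => fderiv ℝ G z w) z v := by
  have hd : DifferentiableAt ℝ (fderiv ℝ G) z :=
    ((hG.fderiv_right (m := (⊤ : ℕ∞)) (by simp)).differentiable (by simp)) z
  have hs := (hG.contDiffAt (x := z)).isSymmSndFDerivAt (by
    rw [minSmoothness_of_isRCLikeNormedField]; exact WithTop.coe_le_coe.2 le_top)
  rw [fderiv_clm_apply hd (by fun_prop), fderiv_clm_apply hd (by fun_prop)]
  simpa using hs w v

theorem aux_foot (T x α : ℝ) (hT : 0 < T) (hα : 0 < α) (R Λ : ℝ × ℝ → ℝ)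
    (hR : ContDiff ℝ (⊤ : ℕ∞) R) (hΛ : ContDiff ℝ (⊤ : ℕ∞) Λ)
    (hP : ∀ t ∈ Set.Icc (0 : ℝ) T, ∀ y : ℝ,
      fderiv ℝ R (t, y) (1, 0) + Λ (t, y) * fderiv ℝ R (t, y) (0, 1) = 0)
    (S : ℝ → ℝ) (hS : ContDiff ℝ (⊤ : ℕ∞) S) (hS0 : S 0 = Λ (0, x))
    (hS1 : deriv S 0 = α * (fderiv ℝ Λ (0, x) (1, 0) - Λ (0, x) * fderiv ℝ Λ (0, x) (0, 1))) :
    (fun t => R (0, x - t * (1 - 1 / (2 * α)) * Λ (0, x) - t * (1 / (2 * α)) * S t) - R (t, x))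
      =O[𝓝[>] (0 : ℝ)] fun t => t ^ 3 := by
  set c := 1 - 1 / (2 * α) with hc
  set d := 1 / (2 * α) with hd
  have hcd : c + d = 1 := by rw [hc]; ring
  have hdα : 2 * d * α = 1 := by rw [hd]; field_simp
  set p : ℝ × ℝ → ℝ := fun z => fderiv ℝ R z (1, 0) with hp
  set q : ℝ × ℝ → ℝ := fun z => fderiv ℝ R z (0, 1) with hq
  have sp : ContDiff ℝ (⊤ : ℕ∞) p := aux_smooth R hR _
  have sq : ContDiff ℝ (⊤ : ℕ∞) q := aux_smooth R hR _
  have hS' : ContDiff ℝ (⊤ : ℕ∞) (deriv S) := (contDiff_infty_iff_deriv.1 hS).2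
  have hSd : ∀ t, HasDerivAt S (deriv S t) t := fun t =>
    ((hS.differentiable (by simp)) t).hasDerivAt
  have hSd' : HasDerivAt (deriv S) (deriv (deriv S) 0) 0 :=
    ((hS'.differentiable (by simp)) 0).hasDerivAt
  set ξ : ℝ → ℝ := fun t => x - t * c * Λ (0, x) - t * d * S t with hξ
  set ξ' : ℝ → ℝ := fun t => - c * Λ (0, x) - d * S t - t * d * deriv S t with hξ'
  have sξ : ContDiff ℝ (⊤ : ℕ∞) ξ := by fun_prop
  have dξ : ∀ t, HasDerivAt ξ (ξ' t) t := by
    intro t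
    have h1 : HasDerivAt (fun t => t * c * Λ (0, x)) (1 * c * Λ (0, x)) t :=
      ((hasDerivAt_id t).mul_const c).mul_const _
    have h2 : HasDerivAt (fun t => t * d * S t) (1 * d * S t + t * d * deriv S t) t :=
      ((hasDerivAt_id t).mul_const d).mul (hSd t)
    refine (((hasDerivAt_const t x).sub h1).sub h2).congr_deriv ?_
    simp only [hξ']; ring
  have dξ' : HasDerivAt ξ' (- 2 * d * deriv S 0) 0 := by
    have h2 : HasDerivAt (fun t => t * d * deriv S t)
        (1 * d * deriv S 0 + 0 * d * deriv (deriv S) 0) 0 :=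
      ((hasDerivAt_id (0 : ℝ)).mul_const d).mul hSd'
    refine (((hasDerivAt_const (0 : ℝ) (- c * Λ (0, x))).sub ((hSd 0).const_mul d)).sub
      h2).congr_deriv ?_
    ring
  have ξ0 : ξ 0 = x := by simp [hξ]
  have ξ'0 : ξ' 0 = - Λ (0, x) := by
    simp only [hξ', hS0]; linear_combination (- Λ (0, x)) * hcd
  set F : ℝ → ℝ := fun t => R (0, ξ t) - R (t, x) with hF
  have sF : ContDiff ℝ (⊤ : ℕ∞) F := by fun_prop
  have dF : ∀ t, HasDerivAt F (q (0, ξ t) * ξ' t - p (t, x)) t := fun t =>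
    HasDerivAt.sub (HasDerivAt.comp t (aux_px R hR 0 (ξ t)) (dξ t)) (aux_pt R hR t x)
  have dF' : deriv F = fun t => q (0, ξ t) * ξ' t - p (t, x) := funext fun t => (dF t).deriv
  have hP0 : ∀ y, p (0, y) = - Λ (0, y) * q (0, y) := fun y => by
    have := hP 0 ⟨le_rfl, hT.le⟩ y
    simp only [hp, hq]; linarith
  -- mixed derivative
  have hpx : fderiv ℝ p (0, x) (0, 1) =
      - fderiv ℝ Λ (0, x) (0, 1) * q (0, x) + - Λ (0, x) * fderiv ℝ q (0, x) (0, 1) := by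
    have h1 := aux_px p sp 0 x
    have h2 := (aux_px Λ hΛ 0 x).neg.mul (aux_px q sq 0 x)
    have h3 : (fun s => p (0, s)) = (-fun s => Λ (0, s)) * fun s => q (0, s) := by
      funext s; simp [hP0]
    rw [h3] at h1
    exact h1.unique h2
  have hqt : fderiv ℝ q (0, x) (1, 0) = fderiv ℝ p (0, x) (0, 1) := aux_symm R hR _ _ _
  have hpt : fderiv ℝ p (0, x) (1, 0) =
      - fderiv ℝ Λ (0, x) (1, 0) * q (0, x) + - Λ (0, x) * fderiv ℝ q (0, x) (1, 0) := by
    have h1 := (aux_pt p sp 0 x).hasDerivWithinAt (s := Set.Icc 0 T)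
    have h2 := ((aux_pt Λ hΛ 0 x).neg.mul (aux_pt q sq 0 x)).hasDerivWithinAt (s := Set.Icc 0 T)
    have h3 : ∀ s ∈ Set.Icc 0 T, p (s, x) = ((-fun s => Λ (s, x)) * fun s => q (s, x)) s := by
      intro s hs
      have := hP s hs x
      simp only [hp, hq, Pi.mul_apply, Pi.neg_apply]; linarith
    have h4 := h2.congr h3 (h3 0 ⟨le_rfl, hT.le⟩)
    exact (uniqueDiffOn_Icc hT 0 ⟨le_rfl, hT.le⟩).eq_deriv _ h1 h4
  refine aux_taylor F sF ?_ ?_ ?_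
  · simp [hF, ξ0]
  · rw [dF']; simp only [ξ0, ξ'0, hP0]; ring
  · rw [dF']
    have h1 : HasDerivAt (fun t => q (0, ξ t)) (fderiv ℝ q (0, ξ 0) (0, 1) * ξ' 0) 0 :=
      HasDerivAt.comp 0 (aux_px q sq 0 (ξ 0)) (dξ 0)
    have h2 := HasDerivAt.sub (HasDerivAt.mul h1 dξ') (aux_pt p sp 0 x)
    refine h2.deriv.trans ?_
    rw [hpt, hqt, hpx, ξ0, ξ'0, hS1]
    linear_combination (- q (0, x) * (fderiv ℝ Λ (0, x) (1, 0)
      - Λ (0, x) * fderiv ℝ Λ (0, x) (0, 1))) * hdα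

theorem aux_speed (T x α : ℝ) (hT : 0 < T) (hα : 0 < α) (L l1 l2 R Q1 Q2 : ℝ × ℝ → ℝ)
    (hL : ContDiff ℝ (⊤ : ℕ∞) L) (hl1 : ContDiff ℝ (⊤ : ℕ∞) l1) (hl2 : ContDiff ℝ (⊤ : ℕ∞) l2)
    (hR : ContDiff ℝ (⊤ : ℕ∞) R) (hQ1 : ContDiff ℝ (⊤ : ℕ∞) Q1) (hQ2 : ContDiff ℝ (⊤ : ℕ∞) Q2)
    (hP : ∀ t ∈ Set.Icc (0 : ℝ) T, ∀ y : ℝ, fderiv ℝ R (t, y) (1, 0)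
      + L (Q1 (t, y), Q2 (t, y)) * fderiv ℝ R (t, y) (0, 1) = 0)
    (hP1 : fderiv ℝ Q1 (0, x) (1, 0)
      + l1 (Q1 (0, x), Q2 (0, x)) * fderiv ℝ Q1 (0, x) (0, 1) = 0)
    (hP2 : fderiv ℝ Q2 (0, x) (1, 0)
      + l2 (Q1 (0, x), Q2 (0, x)) * fderiv ℝ Q2 (0, x) (0, 1) = 0)
    (ξs S : ℝ → ℝ) (hξs : ξs = fun t => x - α * t * L (Q1 (0, x), Q2 (0, x)))
    (hSdef : S = fun t => L
      (Q1 (0, ξs t - α * t * l1 (Q1 (0, ξs t), Q2 (0, ξs t))),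
       Q2 (0, ξs t - α * t * l2 (Q1 (0, ξs t), Q2 (0, ξs t))))) :
    (fun t => R (0, x - t * (1 - 1 / (2 * α)) * L (Q1 (0, x), Q2 (0, x))
      - t * (1 / (2 * α)) * S t) - R (t, x)) =O[𝓝[>] (0 : ℝ)] fun t => t ^ 3 := by
  have sξ : ContDiff ℝ (⊤ : ℕ∞) ξs := by rw [hξs]; fun_prop
  have ξ0 : ξs 0 = x := by simp [hξs]
  have dξ : HasDerivAt ξs (- α * L (Q1 (0, x), Q2 (0, x))) 0 := by
    rw [hξs]
    refine ((hasDerivAt_const (0 : ℝ) x).sub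
      (((hasDerivAt_id (0 : ℝ)).const_mul α).mul_const (L (Q1 (0, x), Q2 (0, x))))).congr_deriv ?_
    ring
  have key : ∀ l : ℝ × ℝ → ℝ, ContDiff ℝ (⊤ : ℕ∞) l →
      HasDerivAt (fun t => ξs t - α * t * l (Q1 (0, ξs t), Q2 (0, ξs t)))
        (- α * L (Q1 (0, x), Q2 (0, x)) - α * l (Q1 (0, x), Q2 (0, x))) 0 := by
    intro l hl
    have sm : ContDiff ℝ (⊤ : ℕ∞) (fun t => l (Q1 (0, ξs t), Q2 (0, ξs t))) := by fun_prop
    have h1 := ((sm.differentiable (by simp)) 0).hasDerivAt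
    have h2 := dξ.sub (((hasDerivAt_id (0 : ℝ)).const_mul α).mul h1)
    refine h2.congr_deriv ?_
    simp [ξ0]
  have e1 := HasDerivAt.comp (0 : ℝ) (aux_px Q1 hQ1 0 _) (key l1 hl1)
  have e2 := HasDerivAt.comp (0 : ℝ) (aux_px Q2 hQ2 0 _) (key l2 hl2)
  have e3 := ((hL.differentiable (by simp)) _).hasFDerivAt.comp_hasDerivAt (0 : ℝ)
    (e1.prodMk e2)
  have fΛ : ∀ v, fderiv ℝ (fun z => L (Q1 z, Q2 z)) (0, x) v =
      fderiv ℝ L (Q1 (0, x), Q2 (0, x)) (fderiv ℝ Q1 (0, x) v, fderiv ℝ Q2 (0, x) v) := by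
    intro v
    have g := (((hL.differentiable (by simp)) (Q1 (0, x), Q2 (0, x))).hasFDerivAt).comp (0, x)
      ((((hQ1.differentiable (by simp)) (0, x)).hasFDerivAt).prodMk
        (((hQ2.differentiable (by simp)) (0, x)).hasFDerivAt))
    have := g.fderiv
    change fderiv ℝ (fun z => L (Q1 z, Q2 z)) (0, x) = _ at this
    rw [this]; rfl
  refine aux_foot T x α hT hα R (fun z => L (Q1 z, Q2 z)) hR (by fun_prop) hP S ?_ ?_ ?_
  · rw [hSdef]; fun_prop
  · simp [hSdef, ξ0]
  · rw [hSdef]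
    refine e3.deriv.trans ?_
    rw [fΛ, fΛ, ← smul_eq_mul (L _), ← map_smul, ← map_sub, ← smul_eq_mul α (fderiv ℝ L _ _),
      ← map_smul]
    simp only [ξ0, mul_zero, zero_mul, sub_zero, Function.comp]
    congr 1
    ext
    · simp; linear_combination (- α) * hP1
    · simp; linear_combination (- α) * hP2


/-- Runge–Kutta (parameter `α ∈ (0,1]`) approximate evolution operator for a diagonal
2×2 system `∂_t Q_i + λ_i(Q₁,Q₂) ∂_x Q_i = 0`: the footpoints `ξ̂₁, ξ̂₂` built from the
predictors `ξ̂_i* = x − α t λ_i(Q_{1,0}(x), Q_{2,0}(x))` and the corrected speeds `λ_i*`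
satisfy `(Q_{1,0}(ξ̂₁), Q_{2,0}(ξ̂₂)) = (Q₁(t,x), Q₂(t,x)) + O(t³)` as `t → 0⁺`. -/
theorem stmt_9 (T x α : ℝ) (hT : 0 < T) (hα : α ∈ Set.Ioc (0 : ℝ) 1)
    (lam1 lam2 : ℝ → ℝ → ℝ)
    (hlam1 : ContDiff ℝ (⊤ : ℕ∞) fun p : ℝ × ℝ => lam1 p.1 p.2)
    (hlam2 : ContDiff ℝ (⊤ : ℕ∞) fun p : ℝ × ℝ => lam2 p.1 p.2)
    (Q1 Q2 : ℝ → ℝ → ℝ)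
    (hQ1 : ContDiff ℝ (⊤ : ℕ∞) fun pr : ℝ × ℝ => Q1 pr.1 pr.2)
    (hQ2 : ContDiff ℝ (⊤ : ℕ∞) fun pr : ℝ × ℝ => Q2 pr.1 pr.2)
    (hPDE1 : ∀ t ∈ Set.Icc (0 : ℝ) T, ∀ y : ℝ,
      deriv (fun s => Q1 s y) t + lam1 (Q1 t y) (Q2 t y) * deriv (fun z => Q1 t z) y = 0)
    (hPDE2 : ∀ t ∈ Set.Icc (0 : ℝ) T, ∀ y : ℝ,
      deriv (fun s => Q2 s y) t + lam2 (Q1 t y) (Q2 t y) * deriv (fun z => Q2 t z) y = 0) :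
    -- initial data
    let Q10 : ℝ → ℝ := Q1 0
    let Q20 : ℝ → ℝ := Q2 0
    -- predictors ξ̂_i*
    let ξ1s : ℝ → ℝ := fun t => x - α * t * lam1 (Q10 x) (Q20 x)
    let ξ2s : ℝ → ℝ := fun t => x - α * t * lam2 (Q10 x) (Q20 x)
    -- corrected speeds λ_i*
    let lam1s : ℝ → ℝ := fun t =>
      lam1 (Q10 (ξ1s t - α * t * lam1 (Q10 (ξ1s t)) (Q20 (ξ1s t))))
           (Q20 (ξ1s t - α * t * lam2 (Q10 (ξ1s t)) (Q20 (ξ1s t))))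
    let lam2s : ℝ → ℝ := fun t =>
      lam2 (Q10 (ξ2s t - α * t * lam1 (Q10 (ξ2s t)) (Q20 (ξ2s t))))
           (Q20 (ξ2s t - α * t * lam2 (Q10 (ξ2s t)) (Q20 (ξ2s t))))
    -- footpoints ξ̂_i
    let ξ1 : ℝ → ℝ := fun t =>
      x - t * (1 - 1 / (2 * α)) * lam1 (Q10 x) (Q20 x) - t * (1 / (2 * α)) * lam1s t
    let ξ2 : ℝ → ℝ := fun t =>
      x - t * (1 - 1 / (2 * α)) * lam2 (Q10 x) (Q20 x) - t * (1 / (2 * α)) * lam2s t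
    ((fun t => Q10 (ξ1 t) - Q1 t x) =O[𝓝[>] (0 : ℝ)] fun t => t ^ 3) ∧
    ((fun t => Q20 (ξ2 t) - Q2 t x) =O[𝓝[>] (0 : ℝ)] fun t => t ^ 3) := by
  intro Q10 Q20 ξ1s ξ2s lam1s lam2s ξ1 ξ2
  have hP1 : ∀ t ∈ Set.Icc (0 : ℝ) T, ∀ y : ℝ,
      fderiv ℝ (fun z : ℝ × ℝ => Q1 z.1 z.2) (t, y) (1, 0)
      + lam1 (Q1 t y) (Q2 t y) * fderiv ℝ (fun z : ℝ × ℝ => Q1 z.1 z.2) (t, y) (0, 1) = 0 := by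
    intro t ht y
    rw [← (aux_pt _ hQ1 t y).deriv, ← (aux_px _ hQ1 t y).deriv]
    exact hPDE1 t ht y
  have hP2 : ∀ t ∈ Set.Icc (0 : ℝ) T, ∀ y : ℝ,
      fderiv ℝ (fun z : ℝ × ℝ => Q2 z.1 z.2) (t, y) (1, 0)
      + lam2 (Q1 t y) (Q2 t y) * fderiv ℝ (fun z : ℝ × ℝ => Q2 z.1 z.2) (t, y) (0, 1) = 0 := by
    intro t ht y
    rw [← (aux_pt _ hQ2 t y).deriv, ← (aux_px _ hQ2 t y).deriv]
    exact hPDE2 t ht y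
  have h0 : (0 : ℝ) ∈ Set.Icc (0 : ℝ) T := ⟨le_rfl, hT.le⟩
  exact ⟨aux_speed T x α hT hα.1 _ _ _ _ _ _ hlam1 hlam1 hlam2 hQ1 hQ1 hQ2 hP1
      (hP1 0 h0 x) (hP2 0 h0 x) ξ1s lam1s rfl rfl,
    aux_speed T x α hT hα.1 _ _ _ _ _ _ hlam2 hlam1 hlam2 hQ2 hQ1 hQ2 hP2
      (hP1 0 h0 x) (hP2 0 h0 x) ξ2s lam2s rfl rfl⟩
end

section
/- Let Δx > 0, x_i ∈ ℝ and q₋ < q₊, and set r := (q₊ − q₋)/3 > 0. If q̄ > q₊ − r or q̄ < q₋ + r, then the parabolic reconstruction q_recon is not monotone on the cell [x_i − Δx/2, x_i + Δx/2]. -/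
/-- The parabolic reconstruction on the cell `[x_i − Δx/2, x_i + Δx/2]` with boundary
point values `q₋, q₊` and cell average `q̄`. -/
noncomputable def parabolicRecon (Δx xi qm qp qbar : ℝ) (x : ℝ) : ℝ :=
  -3 * (2 * qbar - qm - qp) * ((x - xi) / Δx) ^ 2
    + (qp - qm) * ((x - xi) / Δx) + (6 * qbar - qm - qp) / 4

/-- If `q₋ < q₊` and, with `r = (q₊ − q₋)/3`, the average satisfies `q̄ > q₊ − r` or
`q̄ < q₋ + r`, then the parabolic reconstruction is not monotone on the cell. -/
theorem stmt_11 (Δx xi qm qp qbar : ℝ) (hΔ : 0 < Δx) (hq : qm < qp)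
    (hbar : qbar > qp - (qp - qm) / 3 ∨ qbar < qm + (qp - qm) / 3) :
    ¬ (MonotoneOn (parabolicRecon Δx xi qm qp qbar) (Set.Icc (xi - Δx / 2) (xi + Δx / 2)) ∨
       AntitoneOn (parabolicRecon Δx xi qm qp qbar) (Set.Icc (xi - Δx / 2) (xi + Δx / 2))) := by
  have key : ∀ t : ℝ, parabolicRecon Δx xi qm qp qbar (xi + t * Δx) =
      -3 * (2 * qbar - qm - qp) * t ^ 2 + (qp - qm) * t + (6 * qbar - qm - qp) / 4 := by
    intro t
    have : (xi + t * Δx - xi) / Δx = t := by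
      rw [add_sub_cancel_left, mul_div_assoc, div_self hΔ.ne', mul_one]
    unfold parabolicRecon
    rw [this]
  have mem : ∀ t : ℝ, -1 / 2 ≤ t → t ≤ 1 / 2 →
      xi + t * Δx ∈ Set.Icc (xi - Δx / 2) (xi + Δx / 2) := by
    intro t h1 h2
    constructor <;> nlinarith
  have mono : ∀ s t : ℝ, s ≤ t → xi + s * Δx ≤ xi + t * Δx := by
    intro s t h
    nlinarith
  rintro (h | h)
  · obtain ⟨a, ha⟩ : ∃ a, a = 3 * (2 * qbar - qm - qp) := ⟨_, rfl⟩
    rcases hbar with hb | hb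
    · have hda : qp - qm < a := by linarith
      have ha0 : 0 < a := by linarith
      obtain ⟨t, ht⟩ : ∃ t, t = (qp - qm) / (2 * a) := ⟨_, rfl⟩
      have hd : qp - qm = 2 * a * t := by rw [ht]; field_simp
      have h1 : t < 1 / 2 := by nlinarith
      have h0 : 0 < t := by rw [ht]; exact div_pos (by linarith) (by linarith)
      have := h (mem t (by linarith) h1.le) (mem (1 / 2) (by norm_num) le_rfl) (mono _ _ h1.le)
      rw [key, key, hd, show -3 * (2 * qbar - qm - qp) = -a by linarith] at this
      have h2 : 0 < a * (1 / 2 - t) ^ 2 := mul_pos ha0 (pow_pos (by linarith) 2)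
      nlinarith
    · have hda : a < -(qp - qm) := by linarith
      have ha0 : 0 < -a := by linarith
      obtain ⟨t, ht⟩ : ∃ t, t = -((qp - qm) / (2 * (-a))) := ⟨_, rfl⟩
      have hd : qp - qm = 2 * a * t := by
        have : a ≠ 0 := by linarith
        rw [ht]; field_simp
      have h0 : t < 0 := by
        rw [ht]; exact neg_neg_of_pos (div_pos (by linarith) (by linarith))
      have h1 : -1 / 2 < t := by nlinarith
      have := h (mem (-1 / 2) le_rfl (by norm_num)) (mem t h1.le (by linarith)) (mono _ _ h1.le)
      rw [key, key, hd, show -3 * (2 * qbar - qm - qp) = -a by linarith] at this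
      have h2 : 0 < (-a) * (1 / 2 + t) ^ 2 := mul_pos ha0 (pow_pos (by linarith) 2)
      nlinarith
  · have := h (mem (-1 / 2) le_rfl (by norm_num)) (mem (1 / 2) (by norm_num) le_rfl)
      (mono _ _ (by norm_num))
    rw [key, key] at this
    linarith
end

section
/- Let Δx > 0, x_i ∈ ℝ and q₋ < q̄ < q₊, and set N := (q₊ − q̄)/(q̄ − q₋) > 0. Then the power-law function p_N(x) := q₋ + (q₊ − q₋)·((x − x_i + Δx/2)/Δx)^N on [x_i − Δx/2, x_i + Δx/2] satisfies p_N(x_i − Δx/2) = q₋, p_N(x_i + Δx/2) = q₊, has cell average (1/Δx) ∫_{x_i − Δx/2}^{x_i + Δx/2} p_N(x) dx = q̄, and is monotone nondecreasing. -/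
/-- Power law limiting: for `q₋ < q̄ < q₊` and `N = (q₊ − q̄)/(q̄ − q₋) > 0`, the
function `p_N(x) = q₋ + (q₊ − q₋)((x − x_i + Δx/2)/Δx)^N` interpolates the boundary
values, has cell average `q̄`, and is monotone nondecreasing on the cell. -/
theorem stmt_14 (Δx xi qm qp qbar : ℝ) (hΔ : 0 < Δx)
    (h1 : qm < qbar) (h2 : qbar < qp) :
    let N : ℝ := (qp - qbar) / (qbar - qm)
    let pN : ℝ → ℝ := fun x => qm + (qp - qm) * ((x - xi + Δx / 2) / Δx) ^ N
    0 < N ∧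
    pN (xi - Δx / 2) = qm ∧
    pN (xi + Δx / 2) = qp ∧
    (1 / Δx) * ∫ x in (xi - Δx / 2)..(xi + Δx / 2), pN x = qbar ∧
    MonotoneOn pN (Set.Icc (xi - Δx / 2) (xi + Δx / 2)) := by
  intro N pN
  have hd : 0 < qbar - qm := sub_pos.2 h1
  have hN : 0 < N := div_pos (sub_pos.2 h2) hd
  have hne : Δx ≠ 0 := hΔ.ne'
  refine ⟨hN, ?_, ?_, ?_, ?_⟩
  · have h : (xi - Δx / 2 - xi + Δx / 2) / Δx = 0 := by
      rw [div_eq_zero_iff]; left; ring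
    simp only [pN, h, Real.zero_rpow hN.ne']
    ring
  · have h : (xi + Δx / 2 - xi + Δx / 2) / Δx = 1 := by
      rw [div_eq_one_iff_eq hne]; ring
    simp only [pN, h, Real.one_rpow]
    ring
  · have hI : IntervalIntegrable (fun s : ℝ => s ^ N) MeasureTheory.volume 0 1 :=
      intervalIntegral.intervalIntegrable_rpow' (by linarith)
    have key : ∫ s in (0:ℝ)..1, (qm + (qp - qm) * s ^ N) = qbar := by
      rw [intervalIntegral.integral_add intervalIntegrable_const (hI.const_mul _),
        intervalIntegral.integral_const_mul, integral_rpow (Or.inl (by linarith)),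
        Real.one_rpow, Real.zero_rpow (by linarith)]
      have hN1 : N + 1 = (qp - qm) / (qbar - qm) := by
        simp only [N]; field_simp; ring
      have hpm : qp - qm ≠ 0 := by linarith
      rw [hN1, intervalIntegral.integral_const]
      simp only [smul_eq_mul]
      field_simp
      ring
    have hc := intervalIntegral.integral_comp_div_add
      (a := xi - Δx / 2) (b := xi + Δx / 2)
      (fun s : ℝ => qm + (qp - qm) * s ^ N) hne ((-xi + Δx / 2) / Δx)
    have e0 : (xi - Δx / 2) / Δx + (-xi + Δx / 2) / Δx = 0 := by field_simp; ring
    have e1 : (xi + Δx / 2) / Δx + (-xi + Δx / 2) / Δx = 1 := by field_simp; ring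
    rw [e0, e1, key] at hc
    have hp : pN = fun x => qm + (qp - qm) * (x / Δx + (-xi + Δx / 2) / Δx) ^ N := by
      funext x
      simp only [pN]
      rw [← add_div]
      congr 4
      ring
    rw [hp, hc, smul_eq_mul]
    field_simp
  · intro x hx y hy hxy
    have h0 : 0 ≤ (x - xi + Δx / 2) / Δx := div_nonneg (by linarith [hx.1]) hΔ.le
    have hle : (x - xi + Δx / 2) / Δx ≤ (y - xi + Δx / 2) / Δx :=
      div_le_div_of_nonneg_right (by linarith) hΔ.le
    have := mul_le_mul_of_nonneg_left (Real.rpow_le_rpow h0 hle hN.le)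
      (by linarith : 0 ≤ qp - qm)
    simp only [pN]
    linarith
end

section
/- Let Δx > 0, x_i ∈ ℝ and q₋ < q̄ < q₊, and set N := (q₊ − q̄)/(q̄ − q₋) > 0. Then the mirrored power-law function x ↦ q₊ − (q₊ − q₋)·((Δx/2 − (x − x_i))/Δx)^{1/N} on [x_i − Δx/2, x_i + Δx/2] takes the value q₋ at x_i − Δx/2 and q₊ at x_i + Δx/2, has cell average q̄, and is monotone nondecreasing. -/
/-- Symmetrized power law limiting: for `q₋ < q̄ < q₊` and `N = (q₊ − q̄)/(q̄ − q₋)`, the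
mirrored power law `x ↦ q₊ − (q₊ − q₋)((Δx/2 − (x − x_i))/Δx)^{1/N}` interpolates the
boundary values, has cell average `q̄`, and is monotone nondecreasing on the cell. -/
theorem stmt_15 (Δx xi qm qp qbar : ℝ) (hΔ : 0 < Δx)
    (h1 : qm < qbar) (h2 : qbar < qp) :
    let N : ℝ := (qp - qbar) / (qbar - qm)
    let g : ℝ → ℝ := fun x => qp - (qp - qm) * ((Δx / 2 - (x - xi)) / Δx) ^ (1 / N)
    0 < N ∧
    g (xi - Δx / 2) = qm ∧
    g (xi + Δx / 2) = qp ∧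
    (1 / Δx) * ∫ x in (xi - Δx / 2)..(xi + Δx / 2), g x = qbar ∧
    MonotoneOn g (Set.Icc (xi - Δx / 2) (xi + Δx / 2)) := by
  intro N g
  have ha : 0 < qbar - qm := sub_pos.2 h1
  have hb : 0 < qp - qbar := sub_pos.2 h2
  have hN : 0 < N := div_pos hb ha
  have hM : 0 < 1 / N := one_div_pos.2 hN
  have hΔ' : Δx ≠ 0 := hΔ.ne'
  refine ⟨hN, ?_, ?_, ?_, ?_⟩
  · have e : (Δx / 2 - (xi - Δx / 2 - xi)) / Δx = 1 := by
      field_simp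
      ring
    simp only [g]
    rw [e, Real.one_rpow]
    ring
  · have e : (Δx / 2 - (xi + Δx / 2 - xi)) / Δx = 0 := by
      field_simp
      ring
    simp only [g]
    rw [e, Real.zero_rpow hM.ne']
    ring
  · have hg : g = fun x => (fun s : ℝ => qp - (qp - qm) * s ^ (1 / N))
        ((1 / 2 + xi / Δx) - x / Δx) := by
      funext x
      simp only [g]
      have e : (Δx / 2 - (x - xi)) / Δx = (1 / 2 + xi / Δx) - x / Δx := by
        field_simp
        ring
      rw [e]
    have e0 : (1 / 2 + xi / Δx) - (xi + Δx / 2) / Δx = 0 := by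
      field_simp
      ring
    have e1 : (1 / 2 + xi / Δx) - (xi - Δx / 2) / Δx = 1 := by
      field_simp
      ring
    have hi : IntervalIntegrable (fun s : ℝ => s ^ (1 / N)) MeasureTheory.volume 0 1 :=
      intervalIntegral.intervalIntegrable_rpow' (by linarith)
    rw [hg, intervalIntegral.integral_comp_sub_div (fun s : ℝ => qp - (qp - qm) * s ^ (1 / N)) hΔ',
      e0, e1, intervalIntegral.integral_sub intervalIntegrable_const (hi.const_mul _),
      intervalIntegral.integral_const_mul, integral_rpow (Or.inl (by linarith)),
      Real.one_rpow, Real.zero_rpow (by linarith), intervalIntegral.integral_const]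
    have e2 : (1 - 0) / (1 / N + 1) = (qp - qbar) / (qp - qm) := by
      have h3 : qp - qm ≠ 0 := by linarith
      have h4 : 1 / N + 1 = (qp - qm) / (qp - qbar) := by
        simp only [N]
        field_simp
        ring
      rw [h4, sub_zero, one_div_div]
    rw [e2]
    have h3 : qp - qm ≠ 0 := by linarith
    simp only [smul_eq_mul]
    field_simp
    ring
  · intro x hx y hy hxy
    simp only [g]
    have h0 : 0 ≤ (Δx / 2 - (y - xi)) / Δx := div_nonneg (by linarith [hy.2]) hΔ.le
    have hle : (Δx / 2 - (y - xi)) / Δx ≤ (Δx / 2 - (x - xi)) / Δx :=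
      div_le_div_of_nonneg_right (by linarith) hΔ.le
    have := Real.rpow_le_rpow h0 hle hM.le
    have := mul_le_mul_of_nonneg_left this (by linarith : 0 ≤ qp - qm)
    linarith
end
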